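/- Cut admissibility: the rule i↑ with premise A ⊗ Ā and conclusion ∅ is admissible for GS; that is, for every graph A and every context C[·]_R, if C[A ⊗ Ā]_R is provable in GS then C[∅]_R is provable in GS. -/

import Mathlib

namespace GSP

/-- Atoms: a propositional variable (coded by a natural number) with a polarity. -/
abbrev Atom := ℕ × Bool

/-- The dual atom. -/
def dualAtom (a : Atom) : Atom := (a.1, !a.2)

/-- A finite, simple, undirected graph whose vertices are labelled by atoms. -/
structure LGraph where
  V : Type
  [fintype : Fintype V]
  adj : V → V → Prop
  symm : ∀ {v w : V}, adj v w → adj w v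
  irrefl : ∀ v : V, ¬ adj v v
  label : V → Atom

attribute [instance] LGraph.fintype

namespace LGraph

/-- An isomorphism of labelled graphs: a vertex bijection preserving labels and
preserving and reflecting edges. -/
structure Iso (G H : LGraph) where
  toEquiv : G.V ≃ H.V
  adj_iff : ∀ v w : G.V, G.adj v w ↔ H.adj (toEquiv v) (toEquiv w)
  label_eq : ∀ v : G.V, H.label (toEquiv v) = G.label v

/-- `G ≅ H` : the graphs `G` and `H` are isomorphic. -/
def iso (G H : LGraph) : Prop := Nonempty (Iso G H)

/-- The empty graph. -/
def empty : LGraph where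
  V := Empty
  adj _ _ := False
  symm h := h.elim
  irrefl v := v.elim
  label v := v.elim

/-- The single-vertex graph labelled by the atom `a`. -/
def single (a : Atom) : LGraph where
  V := Unit
  adj _ _ := False
  symm h := h.elim
  irrefl _ h := h
  label _ := a

def parAdj (G H : LGraph) : G.V ⊕ H.V → G.V ⊕ H.V → Prop
  | .inl a, .inl b => G.adj a b
  | .inr a, .inr b => H.adj a b
  | _, _ => False

/-- The par `G ⅋ H` : disjoint union of `G` and `H`. -/
def par (G H : LGraph) : LGraph where
  V := G.V ⊕ H.V
  adj := parAdj G H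
  symm := by
    rintro (a | a) (b | b) h
    · exact G.symm h
    · exact h.elim
    · exact h.elim
    · exact H.symm h
  irrefl := by
    rintro (a | a) h
    · exact G.irrefl a h
    · exact H.irrefl a h
  label := Sum.elim G.label H.label

def tensorAdj (G H : LGraph) : G.V ⊕ H.V → G.V ⊕ H.V → Prop
  | .inl a, .inl b => G.adj a b
  | .inr a, .inr b => H.adj a b
  | .inl _, .inr _ => True
  | .inr _, .inl _ => True

/-- The tensor `G ⊗ H` : join of `G` and `H` (disjoint union plus all edges in between). -/
def tensor (G H : LGraph) : LGraph where
  V := G.V ⊕ H.V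
  adj := tensorAdj G H
  symm := by
    rintro (a | a) (b | b) h
    · exact G.symm h
    · exact trivial
    · exact trivial
    · exact H.symm h
  irrefl := by
    rintro (a | a) h
    · exact G.irrefl a h
    · exact H.irrefl a h
  label := Sum.elim G.label H.label

/-- The dual graph `Ḡ` : same vertices, complemented edges, dualized labels. -/
def dual (G : LGraph) : LGraph where
  V := G.V
  adj v w := v ≠ w ∧ ¬ G.adj v w
  symm h := ⟨fun e => h.1 e.symm, fun h' => h.2 (G.symm h')⟩
  irrefl _ h := h.1 rfl
  label v := dualAtom (G.label v)

def plugAdj (C : LGraph) (R : Set C.V) (X : LGraph) : C.V ⊕ X.V → C.V ⊕ X.V → Prop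
  | .inl a, .inl b => C.adj a b
  | .inr a, .inr b => X.adj a b
  | .inl a, .inr _ => a ∈ R
  | .inr _, .inl b => b ∈ R

/-- `C[X]_R` : the graph obtained from the context `C[·]_R` by inserting the graph `X`
as a module whose vertices are adjacent exactly to the vertices in `R`. -/
def plug (C : LGraph) (R : Set C.V) (X : LGraph) : LGraph where
  V := C.V ⊕ X.V
  adj := plugAdj C R X
  symm := by
    rintro (a | a) (b | b) h
    · exact C.symm h
    · exact h
    · exact h
    · exact X.symm h
  irrefl := by
    rintro (a | a) h
    · exact C.irrefl a h
    · exact X.irrefl a h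
  label := Sum.elim C.label X.label

def compAdj (G : LGraph) (H : G.V → LGraph) :
    (Σ v : G.V, (H v).V) → (Σ v : G.V, (H v).V) → Prop := fun x y =>
  (∃ (v : G.V) (a b : (H v).V), x = ⟨v, a⟩ ∧ y = ⟨v, b⟩ ∧ (H v).adj a b) ∨
    (x.1 ≠ y.1 ∧ G.adj x.1 y.1)

/-- The composition `G⟨H v₁, …, H vₙ⟩` of the family `H` via the graph `G`:
replace each vertex `v` of `G` by the graph `H v`. -/
def comp (G : LGraph) (H : G.V → LGraph) : LGraph where
  V := Σ v : G.V, (H v).V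
  adj := compAdj G H
  symm := by
    rintro x y (⟨v, a, b, hx, hy, hab⟩ | ⟨hne, hadj⟩)
    · exact Or.inl ⟨v, b, a, hy, hx, (H v).symm hab⟩
    · exact Or.inr ⟨hne.symm, G.symm hadj⟩
  irrefl := by
    rintro ⟨v, a⟩ (⟨w, x, y, hx, hy, hxy⟩ | ⟨hne, _⟩)
    · have h := hx.symm.trans hy
      obtain rfl : x = y := by simpa using h
      exact (H w).irrefl x hxy
    · exact hne rfl
  label x := (H x.1).label x.2

/-- A module of `G` : a set `M` of vertices such that every vertex outside `M`
is adjacent either to all vertices of `M` or to none of them. -/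
def IsModule (G : LGraph) (M : Set G.V) : Prop :=
  ∀ v ∉ M, ∀ x ∈ M, ∀ y ∈ M, (G.adj v x ↔ G.adj v y)

/-- A prime graph: at least 2 vertices and only trivial modules. -/
def Prime (G : LGraph) : Prop :=
  2 ≤ Fintype.card G.V ∧
    ∀ M : Set G.V, G.IsModule M → M = ∅ ∨ (∃ v, M = {v}) ∨ M = Set.univ

/-- `G` is `P₄`-free: no four distinct vertices induce a path on 4 vertices. -/
def P4Free (G : LGraph) : Prop :=
  ¬ ∃ v₁ v₂ v₃ v₄ : G.V,
      v₁ ≠ v₂ ∧ v₁ ≠ v₃ ∧ v₁ ≠ v₄ ∧ v₂ ≠ v₃ ∧ v₂ ≠ v₄ ∧ v₃ ≠ v₄ ∧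
      G.adj v₁ v₂ ∧ G.adj v₂ v₃ ∧ G.adj v₃ v₄ ∧
      ¬ G.adj v₁ v₃ ∧ ¬ G.adj v₁ v₄ ∧ ¬ G.adj v₂ v₄

end LGraph

open LGraph

/-- The `n`-fold tensor `X₁ ⊗ ⋯ ⊗ Xₙ`. -/
def bigTensor : (n : ℕ) → (Fin n → LGraph) → LGraph
  | 0, _ => LGraph.empty
  | n + 1, F => (F 0).tensor (bigTensor n fun i => F i.succ)

/-- The `n`-fold par `X₁ ⅋ ⋯ ⅋ Xₙ`. -/
def bigPar : (n : ℕ) → (Fin n → LGraph) → LGraph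
  | 0, _ => LGraph.empty
  | n + 1, F => (F 0).par (bigPar n fun i => F i.succ)

/-- The inference rules of system GS (premise, conclusion). -/
inductive GSRule : LGraph → LGraph → Prop
  /-- ai↓ : premise `∅`, conclusion `ā ⅋ a`. -/
  | ai (a : Atom) : GSRule LGraph.empty ((single (dualAtom a)).par (single a))
  /-- ss↓ : premise `B[A]_S`, conclusion `B ⅋ A`, for `A ≠ ∅` and `S ≠ ∅`. -/
  | ss (A B : LGraph) (S : Set B.V) :
      Nonempty A.V → S ≠ ∅ → GSRule (B.plug S A) (B.par A)
  /-- p↓ : premise `(M₁ ⅋ N₁) ⊗ ⋯ ⊗ (Mₙ ⅋ Nₙ)`, conclusion `P̄⟨M₁,…,Mₙ⟩ ⅋ P⟨N₁,…,Nₙ⟩`,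
  for `P` prime with `n = |V(P)| ≥ 4` and all `Mᵢ ≠ ∅`. -/
  | p (n : ℕ) (P : LGraph) (e : P.V ≃ Fin n) (M N : Fin n → LGraph) :
      P.Prime → 4 ≤ n → (∀ i, Nonempty (M i).V) →
      GSRule (bigTensor n fun i => (M i).par (N i))
        ((P.dual.comp fun v => M (e v)).par (P.comp fun v => N (e v)))

/-- The "up" rules ai↑, ss↑, p↑ (premise, conclusion). -/
inductive UpRule : LGraph → LGraph → Prop
  /-- ai↑ : premise `a ⊗ ā`, conclusion `∅`. -/
  | ai (a : Atom) : UpRule ((single a).tensor (single (dualAtom a))) LGraph.empty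
  /-- ss↑ : premise `B ⊗ A`, conclusion `B[A]_S`, for `A ≠ ∅` and `S ≠ V(B)`. -/
  | ss (A B : LGraph) (S : Set B.V) :
      Nonempty A.V → S ≠ Set.univ → UpRule (B.tensor A) (B.plug S A)
  /-- p↑ : premise `P⟨M₁,…,Mₙ⟩ ⊗ P̄⟨N₁,…,Nₙ⟩`, conclusion `(M₁ ⊗ N₁) ⅋ ⋯ ⅋ (Mₙ ⊗ Nₙ)`,
  for `P` prime with `n = |V(P)| ≥ 4` and all `Mᵢ ≠ ∅`. -/
  | p (n : ℕ) (P : LGraph) (e : P.V ≃ Fin n) (M N : Fin n → LGraph) :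
      P.Prime → 4 ≤ n → (∀ i, Nonempty (M i).V) →
      UpRule ((P.comp fun v => M (e v)).tensor (P.dual.comp fun v => N (e v)))
        (bigPar n fun i => (M i).tensor (N i))

/-- The rules of system SGS : the rules of GS together with their duals. -/
def SGSRule (G H : LGraph) : Prop := GSRule G H ∨ UpRule G H

/-- A single inference step in a system: inside some context, replace a module
isomorphic to the premise of a rule by the corresponding conclusion. -/
def Step (Rules : LGraph → LGraph → Prop) (G H : LGraph) : Prop :=
  ∃ (C : LGraph) (R : Set C.V) (p c : LGraph),
    Rules p c ∧ G.iso (C.plug R p) ∧ H.iso (C.plug R c)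

/-- A derivation in a system from `G` to `H` : a finite sequence of inference steps
and isomorphisms leading from `G` to `H`. -/
def Deriv (Rules : LGraph → LGraph → Prop) (G H : LGraph) : Prop :=
  Relation.ReflTransGen (fun X Y => X.iso Y ∨ Step Rules X Y) G H

/-- A graph is provable in a system if there is a derivation from `∅` to it. -/
def Provable (Rules : LGraph → LGraph → Prop) (G : LGraph) : Prop :=
  Deriv Rules LGraph.empty G

/-- Formulas: unit, positive and negative atoms, par and tensor. -/
inductive Formula where
  | unit : Formula
  | pos (a : ℕ) : Formula
  | neg (a : ℕ) : Formula
  | par (φ ψ : Formula) : Formula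
  | tens (φ ψ : Formula) : Formula

/-- The graph `[φ]` of a formula `φ`. -/
def Formula.graph : Formula → LGraph
  | .unit => LGraph.empty
  | .pos a => single (a, true)
  | .neg a => single (a, false)
  | .par φ ψ => φ.graph.par ψ.graph
  | .tens φ ψ => φ.graph.tensor ψ.graph

/-- Structural equivalence of formulas: the smallest congruence making `⅋` and `⊗`
associative and commutative with unit `∘`. -/
inductive Formula.equiv : Formula → Formula → Prop
  | refl (φ) : Formula.equiv φ φ
  | symm {φ ψ} : Formula.equiv φ ψ → Formula.equiv ψ φ
  | trans {φ ψ χ} : Formula.equiv φ ψ → Formula.equiv ψ χ → Formula.equiv φ χ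
  | parComm (φ ψ) : Formula.equiv (.par φ ψ) (.par ψ φ)
  | parAssoc (φ ψ χ) : Formula.equiv (.par φ (.par ψ χ)) (.par (.par φ ψ) χ)
  | parUnit (φ) : Formula.equiv (.par φ .unit) φ
  | tensComm (φ ψ) : Formula.equiv (.tens φ ψ) (.tens ψ φ)
  | tensAssoc (φ ψ χ) : Formula.equiv (.tens φ (.tens ψ χ)) (.tens (.tens φ ψ) χ)
  | tensUnit (φ) : Formula.equiv (.tens φ .unit) φ
  | parCongr {φ φ' ψ ψ'} : Formula.equiv φ φ' → Formula.equiv ψ ψ' →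
      Formula.equiv (.par φ ψ) (.par φ' ψ')
  | tensCongr {φ φ' ψ ψ'} : Formula.equiv φ φ' → Formula.equiv ψ ψ' →
      Formula.equiv (.tens φ ψ) (.tens φ' ψ')

/-- A formula is unit-free if it contains no occurrence of the unit `∘`. -/
def Formula.UnitFree : Formula → Prop
  | .unit => False
  | .pos _ => True
  | .neg _ => True
  | .par φ ψ => φ.UnitFree ∧ ψ.UnitFree
  | .tens φ ψ => φ.UnitFree ∧ ψ.UnitFree

/-- The sequent calculus MLL° (multiplicative linear logic with mix) on multisets
of formulas. -/
inductive MLL : Multiset Formula → Prop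
  | ax (a : ℕ) : MLL {Formula.pos a, Formula.neg a}
  | tens {Γ Δ : Multiset Formula} (φ ψ : Formula) :
      MLL (φ ::ₘ Γ) → MLL (ψ ::ₘ Δ) → MLL (Formula.tens φ ψ ::ₘ (Γ + Δ))
  | par {Γ : Multiset Formula} (φ ψ : Formula) :
      MLL (φ ::ₘ ψ ::ₘ Γ) → MLL (Formula.par φ ψ ::ₘ Γ)
  | mix {Γ Δ : Multiset Formula} : MLL Γ → MLL Δ → MLL (Γ + Δ)

open LGraph

/-! ## Basic isomorphisms -/

namespace LGraph

theorem iso_refl (G : LGraph) : G.iso G :=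
  ⟨⟨Equiv.refl _, fun _ _ => Iff.rfl, fun _ => rfl⟩⟩

theorem iso_symm {G H : LGraph} (h : G.iso H) : H.iso G := by
  obtain ⟨e, h1, h2⟩ := h
  refine ⟨⟨e.symm, fun v w => ?_, fun v => ?_⟩⟩
  · obtain ⟨v, rfl⟩ := e.surjective v
    obtain ⟨w, rfl⟩ := e.surjective w
    rw [e.symm_apply_apply, e.symm_apply_apply]
    exact (h1 v w).symm
  · obtain ⟨v, rfl⟩ := e.surjective v
    rw [e.symm_apply_apply]
    exact (h2 v).symm

theorem iso_trans {G H K : LGraph} (h : G.iso H) (h' : H.iso K) : G.iso K := by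
  obtain ⟨e, h1, h2⟩ := h
  obtain ⟨f, h3, h4⟩ := h'
  refine ⟨⟨e.trans f, fun v w => ?_, fun v => ?_⟩⟩
  · exact (h1 v w).trans (h3 _ _)
  · exact (h4 _).trans (h2 v)

theorem iso_card {G H : LGraph} (h : G.iso H) : Fintype.card G.V = Fintype.card H.V := by
  obtain ⟨e, _, _⟩ := h
  exact Fintype.card_congr e

theorem iso_nonempty {G H : LGraph} (h : G.iso H) (hG : Nonempty G.V) : Nonempty H.V := by
  obtain ⟨e, _, _⟩ := h
  exact hG.map e

theorem iso_of_isEmpty {G H : LGraph} (hG : IsEmpty G.V) (hH : IsEmpty H.V) : G.iso H :=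
  ⟨⟨Equiv.equivOfIsEmpty _ _, fun v => hG.elim v, fun v => hG.elim v⟩⟩

instance : IsEmpty LGraph.empty.V := inferInstanceAs (IsEmpty Empty)

/-- Isomorphism of contexts. -/
def ctxIso (C : LGraph) (R : Set C.V) (D : LGraph) (S : Set D.V) : Prop :=
  ∃ e : Iso C D, ∀ v, v ∈ R ↔ e.toEquiv v ∈ S

theorem plug_congr {C D : LGraph} {R : Set C.V} {S : Set D.V} (h : ctxIso C R D S)
    {X Y : LGraph} (hX : X.iso Y) : (C.plug R X).iso (D.plug S Y) := by
  obtain ⟨⟨e, h1, h2⟩, h3⟩ := h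
  obtain ⟨f, h4, h5⟩ := hX
  refine ⟨⟨Equiv.sumCongr e f, ?_, ?_⟩⟩
  · rintro (a | a) (b | b)
    · exact h1 a b
    · exact h3 a
    · exact h3 b
    · exact h4 a b
  · rintro (a | a)
    · exact h2 a
    · exact h5 a

theorem ctxIso_refl (C : LGraph) (R : Set C.V) : ctxIso C R C R :=
  ⟨⟨Equiv.refl _, fun _ _ => Iff.rfl, fun _ => rfl⟩, fun _ => Iff.rfl⟩

theorem plug_congr_right {C : LGraph} {R : Set C.V}
    {X Y : LGraph} (hX : X.iso Y) : (C.plug R X).iso (C.plug R Y) :=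
  plug_congr (ctxIso_refl C R) hX

theorem plug_isEmpty (C : LGraph) (R : Set C.V) (X : LGraph) (hX : IsEmpty X.V) :
    (C.plug R X).iso C := by
  refine ⟨⟨Equiv.sumEmpty _ _, ?_, ?_⟩⟩
  · rintro (a | a) (b | b)
    · exact Iff.rfl
    · exact hX.elim b
    · exact hX.elim a
    · exact hX.elim a
  · rintro (a | a)
    · rfl
    · exact hX.elim a

theorem plug_ctx_isEmpty (C : LGraph) (R : Set C.V) (X : LGraph) (hC : IsEmpty C.V) :
    (C.plug R X).iso X := by
  refine ⟨⟨Equiv.emptySum _ _, ?_, ?_⟩⟩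
  · rintro (a | a) (b | b)
    · exact hC.elim a
    · exact hC.elim a
    · exact hC.elim b
    · exact Iff.rfl
  · rintro (a | a)
    · exact hC.elim a
    · rfl

/-- Composition of contexts. -/
def plugSet {C : LGraph} (R : Set C.V) {D : LGraph} (S : Set D.V) : Set (C.plug R D).V :=
  fun x => Sum.elim (fun a => a ∈ R) (fun b => b ∈ S) x

theorem plug_plug (C : LGraph) (R : Set C.V) (D : LGraph) (S : Set D.V) (X : LGraph) :
    (C.plug R (D.plug S X)).iso ((C.plug R D).plug (plugSet R S) X) := by
  refine ⟨⟨(Equiv.sumAssoc _ _ _).symm, ?_, ?_⟩⟩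
  · rintro (a | a | a) (b | b | b) <;> exact Iff.rfl
  · rintro (a | a | a) <;> rfl

theorem par_iso_plug (A B : LGraph) : (A.par B).iso (A.plug ∅ B) := by
  refine ⟨⟨Equiv.refl _, ?_, ?_⟩⟩
  · rintro (a | a) (b | b) <;> exact Iff.rfl
  · rintro (a | a) <;> rfl

/-- The join of two graphs: all edges in between iff `b`. -/
def join (b : Prop) (A B : LGraph) : LGraph := A.plug {_v | b} B

theorem par_iso_join (A B : LGraph) : (A.par B).iso (join False A B) := by
  refine ⟨⟨Equiv.refl _, ?_, ?_⟩⟩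
  · rintro (a | a) (b | b) <;> exact Iff.rfl
  · rintro (a | a) <;> rfl

theorem tensor_iso_join (A B : LGraph) : (A.tensor B).iso (join True A B) := by
  refine ⟨⟨Equiv.refl _, ?_, ?_⟩⟩
  · rintro (a | a) (b | b) <;> exact Iff.rfl
  · rintro (a | a) <;> rfl

theorem join_congr (b : Prop) {A B A' B' : LGraph} (hA : A.iso A') (hB : B.iso B') :
    (join b A B).iso (join b A' B') := by
  obtain ⟨e⟩ := hA
  exact plug_congr (R := {_v | b}) (S := {_v | b}) ⟨e, fun v => Iff.rfl⟩ hB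

theorem join_comm (b : Prop) (A B : LGraph) : (join b A B).iso (join b B A) := by
  refine ⟨⟨Equiv.sumComm _ _, ?_, ?_⟩⟩
  · rintro (a | a) (b | b) <;> exact Iff.rfl
  · rintro (a | a) <;> rfl

theorem par_congr {A B A' B' : LGraph} (hA : A.iso A') (hB : B.iso B') :
    (A.par B).iso (A'.par B') :=
  iso_trans (par_iso_join _ _) (iso_trans (join_congr _ hA hB) (iso_symm (par_iso_join _ _)))

theorem par_comm (A B : LGraph) : (A.par B).iso (B.par A) :=
  iso_trans (par_iso_join _ _) (iso_trans (join_comm _ A B) (iso_symm (par_iso_join _ _)))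

theorem par_assoc (A B C : LGraph) : ((A.par B).par C).iso (A.par (B.par C)) := by
  refine ⟨⟨Equiv.sumAssoc _ _ _, ?_, ?_⟩⟩
  · rintro ((a | a) | a) ((b | b) | b) <;> exact Iff.rfl
  · rintro ((a | a) | a) <;> rfl

theorem par_empty (A : LGraph) : (A.par LGraph.empty).iso A :=
  iso_trans (par_iso_plug _ _) (plug_isEmpty _ _ _ inferInstance)

theorem plug_par (C : LGraph) (R : Set C.V) (K X : LGraph) :
    (C.plug R (K.par X)).iso ((C.plug R K).plug (plugSet R ∅) X) :=
  iso_trans (plug_congr_right (par_iso_plug K X)) (plug_plug C R K ∅ X)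

theorem plug_par_left (C : LGraph) (R : Set C.V) (K X : LGraph) :
    ((C.plug R K).par X).iso ((C.par X).plug (fun x => Sum.elim (fun a => a ∈ R) (fun _ => False) x) K) := by
  refine ⟨⟨⟨fun x => match x with
      | .inl (.inl a) => .inl (.inl a)
      | .inl (.inr a) => .inr a
      | .inr a => .inl (.inr a),
    fun x => match x with
      | .inl (.inl a) => .inl (.inl a)
      | .inr a => .inl (.inr a)
      | .inl (.inr a) => .inr a, ?_, ?_⟩, ?_, ?_⟩⟩
  · rintro ((a | a) | a) <;> rfl
  · rintro ((a | a) | a) <;> rfl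
  · rintro ((a | a) | a) ((b | b) | b) <;> exact Iff.rfl
  · rintro ((a | a) | a) <;> rfl

/-! ### Duals -/

theorem dualAtom_dualAtom (a : Atom) : dualAtom (dualAtom a) = a := by
  simp [dualAtom]

theorem dual_dual (G : LGraph) : G.dual.dual.iso G := by
  refine ⟨⟨Equiv.refl _, ?_, ?_⟩⟩
  · intro v w
    have := G.irrefl v
    constructor
    · rintro ⟨h, h'⟩
      change G.adj v w
      by_contra h2
      exact h' ⟨h, h2⟩
    · intro h
      have : v ≠ w := by rintro rfl; exact this h
      exact ⟨this, fun h' => h'.2 h⟩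
  · intro v
    exact (dualAtom_dualAtom _).symm

theorem dual_congr {G H : LGraph} (h : G.iso H) : G.dual.iso H.dual := by
  obtain ⟨e, h1, h2⟩ := h
  refine ⟨⟨e, ?_, ?_⟩⟩
  · intro v w
    exact and_congr (not_congr e.apply_eq_iff_eq.symm) (not_congr (h1 v w))
  · intro v
    exact congrArg dualAtom (h2 v)

theorem dual_plug (C : LGraph) (R : Set C.V) (X : LGraph) :
    (C.plug R X).dual.iso (C.dual.plug Rᶜ X.dual) := by
  refine ⟨⟨Equiv.refl _, ?_, ?_⟩⟩
  · rintro (a | a) (b | b)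
    · exact and_congr (not_congr Sum.inl_injective.eq_iff) Iff.rfl
    · exact ⟨fun h => h.2, fun h => ⟨fun h' => (by cases h'), h⟩⟩
    · exact ⟨fun h => h.2, fun h => ⟨fun h' => (by cases h'), h⟩⟩
    · exact and_congr (not_congr Sum.inr_injective.eq_iff) Iff.rfl
  · rintro (a | a) <;> rfl

theorem dual_join (b : Prop) (A B : LGraph) :
    (join b A B).dual.iso (join (¬ b) A.dual B.dual) := dual_plug A _ B

theorem dual_comp (P : LGraph) (M : P.V → LGraph) :
    (P.comp M).dual.iso (P.dual.comp fun v => (M v).dual) := by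
  refine ⟨⟨Equiv.refl _, ?_, ?_⟩⟩
  · rintro ⟨v, a⟩ ⟨w, b⟩
    by_cases h : v = w
    · subst h
      constructor
      · rintro ⟨h1, h2⟩
        refine Or.inl ⟨v, a, b, rfl, rfl, ?_, ?_⟩
        · rintro rfl; exact h1 rfl
        · intro h3; exact h2 (Or.inl ⟨v, a, b, rfl, rfl, h3⟩)
      · rintro (⟨u, x, y, hx, hy, h1, h2⟩ | h)
        · cases hx; cases hy
          refine ⟨fun h => h1 (by cases h; rfl), ?_⟩
          rintro (⟨u, x, y, hx, hy, h3⟩ | h)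
          · cases hx; cases hy; exact h2 h3
          · exact h.1 rfl
        · exact (h.1 rfl).elim
    · constructor
      · rintro ⟨h1, h2⟩
        refine Or.inr ⟨h, h, fun h3 => h2 (Or.inr ⟨h, h3⟩)⟩
      · rintro (⟨u, x, y, hx, hy, _⟩ | ⟨h1, h2, h3⟩)
        · cases hx; cases hy; exact (h rfl).elim
        · refine ⟨fun h' => h (congrArg Sigma.fst h'), ?_⟩
          rintro (⟨u, x, y, hx, hy, _⟩ | ⟨h4, h5⟩)
          · cases hx; cases hy; exact (h rfl).elim
          · exact h3 h5
  · intro v; rfl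

theorem dual_nonempty {G : LGraph} (h : Nonempty G.V) : Nonempty G.dual.V := h

theorem dual_card (G : LGraph) : Fintype.card G.dual.V = Fintype.card G.V := rfl

theorem card_plug (C : LGraph) (R : Set C.V) (X : LGraph) :
    Fintype.card (C.plug R X).V = Fintype.card C.V + Fintype.card X.V := by
  have : Fintype.card (C.plug R X).V = Fintype.card (C.V ⊕ X.V) := by
    apply Fintype.card_congr; exact Equiv.refl _
  rw [this, Fintype.card_sum]

theorem card_join (b : Prop) (C X : LGraph) :
    Fintype.card (join b C X).V = Fintype.card C.V + Fintype.card X.V := card_plug _ _ _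

theorem dual_prime {P : LGraph} (h : P.Prime) : P.dual.Prime := by
  refine ⟨h.1, fun M hM => h.2 M ?_⟩
  intro v hv x hx y hy
  have := hM v hv x hx y hy
  have h1 : v ≠ x := by rintro rfl; exact hv hx
  have h2 : v ≠ y := by rintro rfl; exact hv hy
  simp only [dual, h1, h2, ne_eq, not_false_eq_true, true_and] at this
  exact not_iff_not.mp this

/-! ### Compositions -/

theorem comp_adj_same (P : LGraph) (M : P.V → LGraph) (v : P.V) (a b : (M v).V) :
    (P.comp M).adj ⟨v, a⟩ ⟨v, b⟩ ↔ (M v).adj a b := by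
  constructor
  · rintro (⟨u, x, y, hx, hy, h⟩ | h)
    · cases hx; cases hy; exact h
    · exact (h.1 rfl).elim
  · intro h; exact Or.inl ⟨v, a, b, rfl, rfl, h⟩

theorem comp_adj_ne (P : LGraph) (M : P.V → LGraph) {v w : P.V} (h : v ≠ w) (a : (M v).V)
    (b : (M w).V) : (P.comp M).adj ⟨v, a⟩ ⟨w, b⟩ ↔ P.adj v w := by
  constructor
  · rintro (⟨u, x, y, hx, hy, _⟩ | h)
    · cases hx; cases hy; exact (h rfl).elim
    · exact h.2
  · intro h'; exact Or.inr ⟨h, h'⟩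

theorem comp_adj_ne' (P : LGraph) (M : P.V → LGraph) {x y : (P.comp M).V} (h : x.1 ≠ y.1) :
    (P.comp M).adj x y ↔ P.adj x.1 y.1 := comp_adj_ne P M h x.2 y.2

/-- Congruence for compositions. -/
theorem comp_congr {P Q : LGraph} (σ : P.V ≃ Q.V) (hσ : ∀ v w, P.adj v w ↔ Q.adj (σ v) (σ w))
    {M : P.V → LGraph} {N : Q.V → LGraph} (h : ∀ v, (M v).iso (N (σ v))) :
    (P.comp M).iso (Q.comp N) := by
  have f : ∀ v, Iso (M v) (N (σ v)) := fun v => (h v).some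
  refine ⟨⟨Equiv.sigmaCongr σ (fun v => (f v).toEquiv), ?_, ?_⟩⟩
  · rintro ⟨v, a⟩ ⟨w, b⟩
    by_cases hvw : v = w
    · subst hvw
      refine Iff.trans (comp_adj_same _ _ _ _ _) ?_
      refine Iff.trans ((f v).adj_iff a b) ?_
      exact (comp_adj_same Q N (σ v) _ _).symm
    · refine Iff.trans (comp_adj_ne _ _ hvw _ _) (Iff.trans (hσ _ _) ?_)
      exact (comp_adj_ne Q N (fun h => hvw (σ.injective h)) _ _).symm
  · rintro ⟨v, a⟩
    exact (f v).label_eq a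

theorem comp_congr_right {P : LGraph}
    {M : P.V → LGraph} {N : P.V → LGraph} (h : ∀ v, (M v).iso (N v)) :
    (P.comp M).iso (P.comp N) :=
  comp_congr (Equiv.refl _) (fun _ _ => Iff.rfl) h

theorem comp_plug (C : LGraph) (R : Set C.V) (X : LGraph) (M : (C.plug R X).V → LGraph) :
    ((C.plug R X).comp M).iso
      ((C.comp fun v => M (Sum.inl v)).plug {p | p.1 ∈ R} (X.comp fun v => M (Sum.inr v))) := by
  refine ⟨⟨⟨fun x => match x with
      | ⟨.inl v, a⟩ => .inl ⟨v, a⟩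
      | ⟨.inr v, a⟩ => .inr ⟨v, a⟩,
    fun x => match x with
      | .inl ⟨v, a⟩ => ⟨.inl v, a⟩
      | .inr ⟨v, a⟩ => ⟨.inr v, a⟩, ?_, ?_⟩, ?_, ?_⟩⟩
  · rintro ⟨v | v, a⟩ <;> rfl
  · rintro (⟨v, a⟩ | ⟨v, a⟩) <;> rfl
  · rintro ⟨v | v, a⟩ ⟨w | w, b⟩
    · by_cases h : v = w
      · subst h
        refine Iff.trans (comp_adj_same _ _ _ _ _) ?_
        exact (comp_adj_same C (fun v => M (Sum.inl v)) v a b).symm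
      · refine Iff.trans (comp_adj_ne _ _ (fun h' => h (by cases h'; rfl)) _ _) ?_
        exact (comp_adj_ne C (fun v => M (Sum.inl v)) h a b).symm
    · exact comp_adj_ne _ _ (fun h' => by cases h') _ _
    · exact comp_adj_ne _ _ (fun h' => by cases h') _ _
    · by_cases h : v = w
      · subst h
        refine Iff.trans (comp_adj_same _ _ _ _ _) ?_
        exact (comp_adj_same X (fun v => M (Sum.inr v)) v a b).symm
      · refine Iff.trans (comp_adj_ne _ _ (fun h' => h (by cases h'; rfl)) _ _) ?_
        exact (comp_adj_ne X (fun v => M (Sum.inr v)) h a b).symm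
  · rintro ⟨v | v, a⟩ <;> rfl

theorem comp_comp (P : LGraph) (Q : P.V → LGraph) (M : (P.comp Q).V → LGraph) :
    ((P.comp Q).comp M).iso (P.comp fun v => (Q v).comp fun a => M ⟨v, a⟩) := by
  refine ⟨⟨⟨fun x => ⟨x.1.1, ⟨x.1.2, x.2⟩⟩, fun x => ⟨⟨x.1, x.2.1⟩, x.2.2⟩, ?_, ?_⟩, ?_, ?_⟩⟩
  · rintro ⟨⟨v, a⟩, x⟩; rfl
  · rintro ⟨v, ⟨a, x⟩⟩; rfl
  · rintro ⟨⟨v, a⟩, x⟩ ⟨⟨w, b⟩, y⟩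
    by_cases h : v = w
    · subst h
      refine Iff.trans ?_ (comp_adj_same _ _ _ _ _).symm
      by_cases h : a = b
      · subst h
        exact (comp_adj_same _ _ _ _ _).trans (comp_adj_same (Q v) (fun a => M ⟨v, a⟩) a x y).symm
      · refine Iff.trans (comp_adj_ne _ _ (by intro h'; cases h'; exact h rfl) _ _) ?_
        refine Iff.trans (comp_adj_same _ _ _ _ _) ?_
        exact (comp_adj_ne _ _ h _ _).symm
    · refine Iff.trans (comp_adj_ne _ _ (fun h' => h (congrArg Sigma.fst h')) _ _) ?_
      refine Iff.trans (comp_adj_ne _ _ h _ _) ?_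
      exact (comp_adj_ne _ _ h _ _).symm
  · rintro ⟨⟨v, a⟩, x⟩; rfl

theorem comp_single (P : LGraph) (v : P.V) (hv : ∀ w, w = v) (M : P.V → LGraph) :
    (P.comp M).iso (M v) := by
  refine iso_symm ⟨⟨⟨fun x => ⟨v, x⟩, fun x => (hv x.1) ▸ x.2, ?_, ?_⟩, ?_, ?_⟩⟩
  · intro x; rfl
  · rintro ⟨w, x⟩
    obtain rfl := hv w
    rfl
  · intro a b
    exact (comp_adj_same P M v a b).symm
  · intro x; rfl

theorem self_iso_comp (G : LGraph) : G.iso (G.comp fun v => single (G.label v)) := by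
  refine ⟨⟨⟨fun v => ⟨v, ()⟩, fun x => x.1, fun _ => rfl, ?_⟩, ?_, ?_⟩⟩
  · rintro ⟨v, ⟨⟩⟩; rfl
  · intro v w
    by_cases h : v = w
    · subst h
      refine Iff.trans ?_ (comp_adj_same _ _ _ _ _).symm
      exact ⟨fun h => G.irrefl v h, fun h => h.elim⟩
    · exact (comp_adj_ne G _ h _ _).symm
  · intro v; rfl

/-! ### Induced subgraphs -/

open Classical in
/-- Induced subgraph. -/
noncomputable def ind (G : LGraph) (S : Set G.V) : LGraph where
  V := {v : G.V // v ∈ S}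
  adj a b := G.adj a.1 b.1
  symm h := G.symm h
  irrefl v h := G.irrefl v.1 h
  label v := G.label v.1

theorem ind_congr {G H : LGraph} (e : Iso G H) (S : Set G.V) (T : Set H.V)
    (h : ∀ v, v ∈ S ↔ e.toEquiv v ∈ T) : (G.ind S).iso (H.ind T) := by
  refine ⟨⟨Equiv.subtypeEquiv e.toEquiv h, ?_, ?_⟩⟩
  · rintro ⟨a, ha⟩ ⟨b, hb⟩
    exact e.adj_iff a b
  · rintro ⟨a, ha⟩
    exact e.label_eq a

theorem block_iso (P : LGraph) (M : P.V → LGraph) (v : P.V) :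
    (M v).iso ((P.comp M).ind {x : (P.comp M).V | x.1 = v}) := by
  refine ⟨⟨⟨fun a => ⟨⟨v, a⟩, rfl⟩, fun x => x.2 ▸ x.1.2, fun _ => rfl, ?_⟩, ?_, ?_⟩⟩
  · rintro ⟨⟨w, a⟩, h⟩
    cases h; rfl
  · intro a b
    exact (comp_adj_same P M v a b).symm
  · intro a; rfl

/-- Splitting a graph along a set on which a module condition holds. -/
theorem ind_plug (G : LGraph) (S : Set G.V) (R : Set (G.ind Sᶜ).V)
    (h : ∀ (v : (G.ind Sᶜ).V) (w : (G.ind S).V), G.adj v.1 w.1 ↔ v ∈ R) :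
    G.iso ((G.ind Sᶜ).plug R (G.ind S)) := by
  classical
  refine iso_symm ⟨⟨(Equiv.sumComm _ _).trans (Equiv.Set.sumCompl S), ?_, ?_⟩⟩
  · rintro (a | a) (b | b)
    · rfl
    · exact (h a b).symm
    · refine Iff.trans (h b a).symm ?_
      exact ⟨fun h => G.symm h, fun h => G.symm h⟩
    · rfl
  · rintro (a | a) <;> rfl

theorem card_ind_compl (G : LGraph) (S : Set G.V) :
    Fintype.card (G.ind Sᶜ).V + Fintype.card (G.ind S).V = Fintype.card G.V := by
  classical
  have : Fintype.card ((G.ind Sᶜ).V ⊕ (G.ind S).V) = Fintype.card G.V :=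
    Fintype.card_congr ((Equiv.sumComm _ _).trans (Equiv.Set.sumCompl S))
  rwa [Fintype.card_sum] at this

theorem card_ind_lt (G : LGraph) (S : Set G.V) (v : G.V) (hv : v ∉ S) :
    Fintype.card (G.ind S).V < Fintype.card G.V := by
  have := card_ind_compl G S
  have : 0 < Fintype.card (G.ind Sᶜ).V := Fintype.card_pos_iff.2 ⟨⟨v, hv⟩⟩
  omega

/-- The neighbourhood of the block `i` in a composition. -/
def nb (P : LGraph) (i : P.V) (M : P.V → LGraph) : Set (P.comp M).V := {x | P.adj i x.1}

open Classical in
/-- A composition as a context around one of its blocks. -/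
theorem comp_hole (P : LGraph) (i : P.V) (M N : P.V → LGraph)
    (h : ∀ w, w ≠ i → (N w).iso (M w)) :
    (P.comp N).iso ((P.comp (Function.update M i LGraph.empty)).plug (nb P i _) (N i)) := by
  have h' : ∀ w, w ≠ i → (N w).iso (Function.update M i LGraph.empty w) := by
    intro w hw
    rw [Function.update_of_ne hw]; exact h w hw
  have hE : IsEmpty (Function.update M i LGraph.empty i).V := by
    rw [Function.update_self]; infer_instance
  generalize Function.update M i LGraph.empty = M' at h' hE
  have key : ctxIso ((P.comp N).ind {x : (P.comp N).V | x.1 = i}ᶜ) {x | P.adj i x.1.1} (P.comp M') (nb P i M') := by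
    have f : ∀ w, w ≠ i → Iso (N w) (M' w) := fun w hw => (h' w hw).some
    refine ⟨⟨⟨fun x => ⟨x.1.1, (f x.1.1 x.2).toEquiv x.1.2⟩,
      fun x => ⟨⟨x.1, (f x.1 (fun hx => hE.elim (hx ▸ x.2))).toEquiv.symm x.2⟩,
        (fun hx => hE.elim (hx ▸ x.2))⟩, ?_, ?_⟩, ?_, ?_⟩, ?_⟩
    · rintro ⟨⟨v, a⟩, hv⟩
      simp
      rfl
    · rintro ⟨v, a⟩
      simp
      rfl
    · rintro ⟨⟨v, a⟩, hv⟩ ⟨⟨w, b⟩, hw⟩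
      change (P.comp N).adj _ _ ↔ _
      by_cases hvw : v = w
      · subst hvw
        refine Iff.trans (comp_adj_same _ _ _ _ _) ?_
        refine Iff.trans ((f v hv).adj_iff a b) ?_
        exact (comp_adj_same P M' v _ _).symm
      · refine Iff.trans (comp_adj_ne _ _ hvw _ _) ?_
        exact (comp_adj_ne P M' hvw _ _).symm
    · rintro ⟨⟨v, a⟩, hv⟩
      exact (f v hv).label_eq a
    · rintro ⟨⟨v, a⟩, hv⟩
      rfl
  refine iso_trans (ind_plug _ {x : (P.comp N).V | x.1 = i} {x | P.adj i x.1.1} ?_) (plug_congr key ?_)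
  · rintro ⟨⟨v, a⟩, hv⟩ ⟨⟨w, b⟩, hw⟩
    cases hw
    change (P.comp N).adj _ _ ↔ _
    refine Iff.trans (comp_adj_ne _ _ hv _ _) ?_
    exact ⟨fun h => P.symm h, fun h => P.symm h⟩
  · exact iso_symm (block_iso P N i)

end LGraph

/-! ## The ordered monoid of graphs -/

theorem deriv_iso {G H : LGraph} (h : G.iso H) : Deriv GSRule G H :=
  Relation.ReflTransGen.single (Or.inl h)

theorem deriv_rule {G H : LGraph} (h : GSRule G H) : Deriv GSRule G H := by
  refine Relation.ReflTransGen.single (Or.inr ⟨LGraph.empty, ∅, G, H, h, ?_, ?_⟩)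
  · exact iso_symm (plug_ctx_isEmpty _ _ _ inferInstance)
  · exact iso_symm (plug_ctx_isEmpty _ _ _ inferInstance)

theorem Deriv.trans {G H K : LGraph} (h : Deriv GSRule G H) (h' : Deriv GSRule H K) :
    Deriv GSRule G K := Relation.ReflTransGen.trans h h'

theorem step_ctx (C : LGraph) (R : Set C.V) {G H : LGraph} (h : Step GSRule G H) :
    Step GSRule (C.plug R G) (C.plug R H) := by
  obtain ⟨D, S, p, c, hr, h1, h2⟩ := h
  exact ⟨C.plug R D, plugSet R S, p, c, hr,
    iso_trans (plug_congr_right h1) (plug_plug _ _ _ _ _),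
    iso_trans (plug_congr_right h2) (plug_plug _ _ _ _ _)⟩

theorem deriv_ctx (C : LGraph) (R : Set C.V) {G H : LGraph} (h : Deriv GSRule G H) :
    Deriv GSRule (C.plug R G) (C.plug R H) := by
  induction h with
  | refl => exact Relation.ReflTransGen.refl
  | tail _ hs ih =>
    refine ih.trans (Relation.ReflTransGen.single ?_)
    rcases hs with hs | hs
    · exact Or.inl (plug_congr_right hs)
    · exact Or.inr (step_ctx C R hs)

theorem deriv_plug_of_provable (C : LGraph) (R : Set C.V) {X : LGraph}
    (h : Provable GSRule X) : Deriv GSRule C (C.plug R X) :=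
  (deriv_iso (iso_symm (plug_isEmpty C R LGraph.empty inferInstance))).trans (deriv_ctx C R h)

theorem deriv_ss (B : LGraph) (S : Set B.V) (A : LGraph) :
    Deriv GSRule (B.plug S A) (B.par A) := by
  by_cases hA : Nonempty A.V
  · by_cases hS : S = ∅
    · subst hS
      exact deriv_iso (iso_symm (par_iso_plug B A))
    · exact deriv_rule (GSRule.ss A B S hA hS)
  · have hA' : IsEmpty A.V := not_nonempty_iff.1 hA
    exact deriv_iso (iso_trans (plug_isEmpty B S A hA')
      (iso_symm (iso_trans (par_iso_plug B A) (plug_isEmpty B ∅ A hA'))))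

/-- The order relation on graphs. -/
def gle (K L : LGraph) : Prop :=
  ∃ (C : LGraph) (R : Set C.V), Provable GSRule C ∧ Deriv GSRule (C.plug R K) L

theorem gle_of_deriv {K L : LGraph} (h : Deriv GSRule K L) : gle K L :=
  ⟨LGraph.empty, ∅, Relation.ReflTransGen.refl,
    (deriv_iso (plug_ctx_isEmpty _ _ _ inferInstance)).trans h⟩

theorem gle_of_iso {K L : LGraph} (h : K.iso L) : gle K L := gle_of_deriv (deriv_iso h)

theorem gle_trans {K L M : LGraph} (h : gle K L) (h' : gle L M) : gle K M := by
  obtain ⟨C, R, hC, h1⟩ := h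
  obtain ⟨D, S, hD, h2⟩ := h'
  refine ⟨D.plug S C, plugSet S R, ?_, ?_⟩
  · exact Deriv.trans hD (deriv_plug_of_provable D S hC)
  · exact (deriv_iso (iso_symm (plug_plug D S C R K))).trans ((deriv_ctx D S h1).trans h2)

theorem deriv_par_left {K L : LGraph} (X : LGraph) (h : Deriv GSRule K L) :
    Deriv GSRule (K.par X) (L.par X) := by
  refine (deriv_iso (iso_trans (par_comm K X) (par_iso_plug X K))).trans ?_
  refine (deriv_ctx X ∅ h).trans ?_
  exact deriv_iso (iso_symm (iso_trans (par_comm L X) (par_iso_plug X L)))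

theorem gle_par {K L : LGraph} (X : LGraph) (h : gle K L) : gle (K.par X) (L.par X) := by
  obtain ⟨C, R, hC, h1⟩ := h
  refine ⟨C, R, hC, ?_⟩
  refine (deriv_iso (plug_par C R K X)).trans ?_
  exact (deriv_ss _ _ X).trans (deriv_par_left X h1)

/-- Isomorphism as a setoid. -/
def graphSetoid : Setoid LGraph where
  r := LGraph.iso
  iseqv := ⟨iso_refl, iso_symm, iso_trans⟩

/-- Isomorphism classes of graphs. -/
def GG : Type 1 := Quotient graphSetoid

/-- The class of a graph. -/
def gm (G : LGraph) : GG := Quotient.mk graphSetoid G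

theorem gm_eq {G H : LGraph} (h : G.iso H) : gm G = gm H := Quotient.sound h

theorem gm_surj (x : GG) : ∃ G, x = gm G := by
  obtain ⟨G, rfl⟩ := Quotient.exists_rep x
  exact ⟨G, rfl⟩

instance : CommMonoid GG where
  mul := Quotient.map₂ LGraph.par (fun _ _ h _ _ h' => par_congr h h')
  one := gm LGraph.empty
  mul_assoc := by
    rintro ⟨a⟩ ⟨b⟩ ⟨c⟩
    exact Quotient.sound (par_assoc a b c)
  one_mul := by
    rintro ⟨a⟩
    exact Quotient.sound (iso_trans (par_comm _ _) (par_empty a))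
  mul_one := by
    rintro ⟨a⟩
    exact Quotient.sound (par_empty a)
  mul_comm := by
    rintro ⟨a⟩ ⟨b⟩
    exact Quotient.sound (par_comm a b)

theorem gm_mul (G H : LGraph) : gm G * gm H = gm (G.par H) := rfl

theorem gm_empty : gm LGraph.empty = 1 := rfl

theorem gm_isEmpty {G : LGraph} (h : IsEmpty G.V) : gm G = 1 :=
  gm_eq (iso_of_isEmpty h inferInstance)

instance : Preorder GG where
  le := Quotient.lift₂ gle (by
    intro a b c d h h'
    refine propext ⟨fun h1 => ?_, fun h1 => ?_⟩
    · exact gle_trans (gle_of_iso (iso_symm h)) (gle_trans h1 (gle_of_iso h'))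
    · exact gle_trans (gle_of_iso h) (gle_trans h1 (gle_of_iso (iso_symm h'))))
  le_refl := by
    rintro ⟨a⟩
    exact gle_of_iso (iso_refl a)
  le_trans := by
    rintro ⟨a⟩ ⟨b⟩ ⟨c⟩ h h'
    exact gle_trans h h'

theorem gm_le {G H : LGraph} : gm G ≤ gm H ↔ gle G H := Iff.rfl

instance : MulLeftMono GG := ⟨by
  rintro ⟨a⟩ ⟨b⟩ ⟨c⟩ h
  exact gle_trans (gle_of_iso (par_comm a b)) (gle_trans (gle_par a h) (gle_of_iso (par_comm c a)))⟩

theorem one_le_gm {G : LGraph} : 1 ≤ gm G ↔ Provable GSRule G := by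
  constructor
  · rintro ⟨C, R, hC, h⟩
    exact Deriv.trans hC ((deriv_iso (iso_symm (plug_isEmpty C R _ inferInstance))).trans h)
  · intro h
    exact gle_of_deriv h

theorem gm_le_of_deriv {G H : LGraph} (h : Deriv GSRule G H) : gm G ≤ gm H := gle_of_deriv h

theorem gm_le_plug {C : LGraph} (R : Set C.V) (K : LGraph) (h : 1 ≤ gm C) :
    gm K ≤ gm (C.plug R K) :=
  ⟨C, R, one_le_gm.1 h, Relation.ReflTransGen.refl⟩

theorem gm_plug_le_mul (B : LGraph) (S : Set B.V) (A : LGraph) :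
    gm (B.plug S A) ≤ gm B * gm A := gm_le_of_deriv (deriv_ss B S A)

theorem gm_le_plug_of_provable (C : LGraph) (R : Set C.V) {X : LGraph} (h : 1 ≤ gm X) :
    gm C ≤ gm (C.plug R X) := gm_le_of_deriv (deriv_plug_of_provable C R (one_le_gm.1 h))

theorem one_le_plug {C : LGraph} (R : Set C.V) {X : LGraph} (h : 1 ≤ gm C) (h' : 1 ≤ gm X) :
    1 ≤ gm (C.plug R X) := h.trans (gm_le_plug_of_provable C R h')

theorem gm_join_le (b : Prop) (A B : LGraph) : gm (join b A B) ≤ gm A * gm B :=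
  gm_plug_le_mul _ _ _

theorem gm_join_false (A B : LGraph) : gm (join False A B) = gm A * gm B :=
  (gm_eq (par_iso_join A B)).symm

theorem gm_ax (a : Atom) : 1 ≤ gm (single (dualAtom a)) * gm (single a) :=
  gm_le_of_deriv (deriv_rule (GSRule.ai a))

theorem one_le_bigTensor : ∀ (n : ℕ) (F : Fin n → LGraph), (∀ w, 1 ≤ gm (F w)) →
    1 ≤ gm (bigTensor n F)
  | 0, _, _ => le_refl _
  | n + 1, F, h => by
    change 1 ≤ gm ((F 0).tensor _)
    rw [gm_eq (tensor_iso_join _ _)]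
    exact one_le_plug _ (h 0) (one_le_bigTensor n _ fun w => h w.succ)

theorem le_bigTensor : ∀ (n : ℕ) (F : Fin n → LGraph) (i : Fin n), (∀ w, w ≠ i → 1 ≤ gm (F w)) →
    gm (F i) ≤ gm (bigTensor n F)
  | 0, _, i, _ => i.elim0
  | n + 1, F, i, h => by
    change _ ≤ gm ((F 0).tensor _)
    rw [gm_eq (tensor_iso_join _ _)]
    refine Fin.cases (motive := fun i => (∀ w, w ≠ i → 1 ≤ gm (F w)) → gm (F i) ≤ _) ?_ ?_ i h
    · intro h
      exact gm_le_plug_of_provable _ _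
        (one_le_bigTensor n _ fun w => h w.succ (Fin.succ_ne_zero w))
    · intro j h
      refine (le_bigTensor n (fun i => F i.succ) j ?_).trans ?_
      · intro w hw
        exact h _ (fun h' => hw (Fin.succ_injective _ h'))
      · exact gm_le_plug _ _ (h 0 (Fin.succ_ne_zero j).symm)

theorem prime_le {P : LGraph} (hP : P.Prime) (h4 : 4 ≤ Fintype.card P.V) (J J' : P.V → LGraph)
    (hJ : ∀ v, Nonempty (J v).V) (i : P.V) (h : ∀ w, w ≠ i → 1 ≤ gm (J w) * gm (J' w)) :
    gm (J i) * gm (J' i) ≤ gm (P.dual.comp J) * gm (P.comp J') := by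
  let e := Fintype.equivFin P.V
  have h1 := deriv_rule (GSRule.p _ P e (fun i => J (e.symm i)) (fun i => J' (e.symm i)) hP h4
    (fun i => hJ _))
  have h2 := gm_le_of_deriv h1
  have e1 : ∀ K : P.V → LGraph, (fun v => K (e.symm (e v))) = K := by
    intro K; funext v; rw [e.symm_apply_apply]
  have e2 : (P.dual.comp fun v => J (e.symm (e v))) = P.dual.comp J :=
    congrArg P.dual.comp (e1 J)
  rw [e2, e1 J'] at h2
  refine le_trans ?_ h2
  have h3 := le_bigTensor _ (fun i => (J (e.symm i)).par (J' (e.symm i))) (e i) ?_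
  · simpa [gm_mul] using h3
  · intro w hw
    exact h _ (fun h' => hw (by rw [← h', e.apply_symm_apply]))

open Classical in
theorem comp_update_mul_le (P : LGraph) (i : P.V) (L : P.V → LGraph) (K : LGraph) :
    gm (P.comp (Function.update L i ((L i).par K))) ≤ gm (P.comp L) * gm K := by
  have h1 := comp_hole P i L (Function.update L i ((L i).par K))
    (fun w hw => by rw [Function.update_of_ne hw]; exact iso_refl _)
  have h2 := comp_hole P i L L (fun w hw => iso_refl _)
  rw [Function.update_self] at h1
  rw [gm_eq h1, gm_eq h2, gm_eq (plug_par _ _ _ _)]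
  exact gm_plug_le_mul _ _ _

/-! ## Graph lemmas -/

namespace LGraph

theorem align {P : LGraph} (hP : P.Prime) (h3 : 3 ≤ Fintype.card P.V) {M : P.V → LGraph}
    (hM : ∀ v, Nonempty (M v).V) (S : Set (P.comp M).V) (hS : (P.comp M).IsModule S)
    (hne : S.Nonempty) : S = Set.univ ∨ ∃ i, ∀ x ∈ S, x.1 = i := by
  classical
  by_cases hU : S = Set.univ
  · exact Or.inl hU
  right
  have hT : P.IsModule {v | ∃ x ∈ S, x.1 = v} := by
    rintro v hv _ ⟨x, hx, rfl⟩ _ ⟨y, hy, rfl⟩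
    obtain ⟨m⟩ := hM v
    have h1 : (⟨v, m⟩ : (P.comp M).V) ∉ S := fun h => hv ⟨_, h, rfl⟩
    have h2 := hS _ h1 x hx y hy
    have hx' : v ≠ x.1 := fun h => hv ⟨x, hx, h.symm⟩
    have hy' : v ≠ y.1 := fun h => hv ⟨y, hy, h.symm⟩
    exact (comp_adj_ne P M hx' m x.2).symm.trans (h2.trans (comp_adj_ne P M hy' m y.2))
  rcases hP.2 _ hT with h | ⟨i, h⟩ | h
  · obtain ⟨x, hx⟩ := hne
    have : x.1 ∈ {v | ∃ x ∈ S, x.1 = v} := ⟨x, hx, rfl⟩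
    rw [h] at this
    exact this.elim
  · refine ⟨i, fun x hx => ?_⟩
    have : x.1 ∈ {v | ∃ x ∈ S, x.1 = v} := ⟨x, hx, rfl⟩
    rw [h] at this
    exact this
  · exfalso
    obtain ⟨⟨v, m⟩, hv⟩ := (Set.ne_univ_iff_exists_notMem S).1 hU
    have hall : ∀ w, ∃ x ∈ S, x.1 = w := fun w => by
      have : w ∈ (Set.univ : Set P.V) := trivial
      rw [← h] at this
      exact this
    have hT2 : P.IsModule {v}ᶜ := by
      intro u hu a ha b hb
      have hu' : u = v := by by_contra h; exact hu h
      subst hu'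
      obtain ⟨x, hx, rfl⟩ := hall a
      obtain ⟨y, hy, rfl⟩ := hall b
      have h2 := hS _ hv x hx y hy
      exact (comp_adj_ne P M (fun h => ha h.symm) m x.2).symm.trans
        (h2.trans (comp_adj_ne P M (fun h => hb h.symm) m y.2))
    have hcard : 2 ≤ ({v}ᶜ : Set P.V).ncard := by
      have := Set.ncard_add_ncard_compl ({v} : Set P.V)
      rw [Set.ncard_singleton, Nat.card_eq_fintype_card] at this
      omega
    rcases hP.2 _ hT2 with h | ⟨i, h⟩ | h
    · rw [h] at hcard; simp at hcard
    · rw [h] at hcard; simp at hcard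
    · have : v ∈ ({v}ᶜ : Set P.V) := by rw [h]; trivial
      exact this rfl

theorem block_module (P : LGraph) (M : P.V → LGraph) (v : P.V) :
    (P.comp M).IsModule {x : (P.comp M).V | x.1 = v} := by
  rintro ⟨w, a⟩ hw ⟨_, x⟩ rfl ⟨_, y⟩ hy
  cases hy
  exact (comp_adj_ne P M hw a x).trans (comp_adj_ne P M hw a y).symm

theorem module_image {G H : LGraph} (e : Iso G H) {S : Set G.V} (h : G.IsModule S) :
    H.IsModule (e.toEquiv '' S) := by
  rintro v hv _ ⟨x, hx, rfl⟩ _ ⟨y, hy, rfl⟩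
  obtain ⟨v, rfl⟩ := e.toEquiv.surjective v
  have hv' : v ∉ S := fun h => hv ⟨v, h, rfl⟩
  exact (e.adj_iff v x).symm.trans ((h v hv' x hx y hy).trans (e.adj_iff v y))

theorem join_module_left (b : Prop) (A B : LGraph) :
    (join b A B).IsModule {x : A.V ⊕ B.V | x.isLeft = true} := by
  rintro (v | v) hv (x | x) hx (y | y) hy
  · exact (hv rfl).elim
  · exact (hv rfl).elim
  · exact (hv rfl).elim
  · exact (hv rfl).elim
  · exact Iff.rfl
  · cases (show false = true from hy)
  · cases (show false = true from hx)
  · cases (show false = true from hx)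

theorem join_module_right (b : Prop) (A B : LGraph) :
    (join b A B).IsModule {x : A.V ⊕ B.V | x.isLeft = false} := by
  rintro (v | v) hv (x | x) hx (y | y) hy
  · cases (show true = false from hx)
  · cases (show true = false from hx)
  · cases (show true = false from hy)
  · exact Iff.rfl
  · exact (hv rfl).elim
  · exact (hv rfl).elim
  · exact (hv rfl).elim
  · exact (hv rfl).elim

theorem join_not_prime (b : Prop) {A B : LGraph} (hA : Nonempty A.V) (hB : Nonempty B.V)
    {P : LGraph} (hP : P.Prime) (h3 : 3 ≤ Fintype.card P.V) {M : P.V → LGraph}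
    (hM : ∀ v, Nonempty (M v).V) (h : (join b A B).iso (P.comp M)) : False := by
  classical
  obtain ⟨e⟩ := h
  obtain ⟨a⟩ := hA
  obtain ⟨c⟩ := hB
  have h1 := align hP h3 hM _ (module_image e (join_module_left b A B))
    ⟨_, Sum.inl a, rfl, rfl⟩
  have h2 := align hP h3 hM _ (module_image e (join_module_right b A B))
    ⟨_, Sum.inr c, rfl, rfl⟩
  rcases h1 with h1 | ⟨i, hi⟩
  · have : e.toEquiv (Sum.inr c) ∈ (Set.univ : Set (P.comp M).V) := trivial
    rw [← h1] at this
    obtain ⟨x, hx, hx'⟩ := this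
    obtain rfl := e.toEquiv.injective hx'
    cases (show false = true from hx)
  rcases h2 with h2 | ⟨j, hj⟩
  · have : e.toEquiv (Sum.inl a) ∈ (Set.univ : Set (P.comp M).V) := trivial
    rw [← h2] at this
    obtain ⟨x, hx, hx'⟩ := this
    obtain rfl := e.toEquiv.injective hx'
    cases (show true = false from hx)
  have hall : ∀ v : P.V, v ∈ ({i, j} : Finset P.V) := by
    intro v
    obtain ⟨m⟩ := hM v
    obtain ⟨x, hx⟩ := e.toEquiv.surjective (⟨v, m⟩ : (P.comp M).V)
    rcases x with x | x
    · have := hi _ ⟨Sum.inl x, rfl, rfl⟩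
      have h' : (e.toEquiv (Sum.inl x)).1 = v := by rw [hx]
      simp [← h', this]
    · have := hj _ ⟨Sum.inr x, rfl, rfl⟩
      have h' : (e.toEquiv (Sum.inr x)).1 = v := by rw [hx]
      simp [← h', this]
  have : Fintype.card P.V ≤ 2 := by
    have h1 : (Finset.univ : Finset P.V) ⊆ {i, j} := fun v _ => hall v
    exact (Finset.card_le_card h1).trans Finset.card_le_two
  omega

theorem join_false_true {A B A' B' : LGraph} (hA : Nonempty A.V) (hB : Nonempty B.V)
    (hA' : Nonempty A'.V) (hB' : Nonempty B'.V) (h : (join False A B).iso (join True A' B')) :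
    False := by
  obtain ⟨e⟩ := h
  obtain ⟨a⟩ := hA
  obtain ⟨c⟩ := hB
  obtain ⟨a'⟩ := hA'
  obtain ⟨c'⟩ := hB'
  let s : A.V ⊕ B.V → Bool := fun x => Sum.isLeft (α := A'.V) (β := B'.V) (e.toEquiv x)
  have h1 : ∀ x y, s (.inl x) = s (.inr y) := by
    intro x y
    have h2 := e.adj_iff (Sum.inl x) (Sum.inr y)
    have h3 : ¬ (join False A B).adj (Sum.inl x) (Sum.inr y) := fun h => h
    rw [h2] at h3
    change Sum.isLeft (α := A'.V) (β := B'.V) (e.toEquiv _) =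
      Sum.isLeft (α := A'.V) (β := B'.V) (e.toEquiv _)
    revert h3
    generalize e.toEquiv (Sum.inl x) = u
    generalize e.toEquiv (Sum.inr y) = v
    rcases u with u | u <;> rcases v with v | v <;> intro h3
    · rfl
    · exact (h3 trivial).elim
    · exact (h3 trivial).elim
    · rfl
  have h2 : ∀ x, s x = s (.inl a) := by
    rintro (x | x)
    · exact (h1 x c).trans (h1 a c).symm
    · exact (h1 a x).symm
  obtain ⟨u, hu⟩ := e.toEquiv.surjective (Sum.inl a')
  obtain ⟨v, hv⟩ := e.toEquiv.surjective (Sum.inr c')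
  have h3 : s u = true := by
    change Sum.isLeft (α := A'.V) (β := B'.V) (e.toEquiv _) = _
    rw [hu]; rfl
  have h4 : s v = false := by
    change Sum.isLeft (α := A'.V) (β := B'.V) (e.toEquiv _) = _
    rw [hv]; rfl
  rw [h2 u, ← h2 v, h4] at h3
  cases h3

theorem comp_iso_map {P P' : LGraph} {M : P.V → LGraph} {M' : P'.V → LGraph}
    (hP' : P'.Prime) (h3 : 3 ≤ Fintype.card P'.V) (h2 : 2 ≤ Fintype.card P.V)
    (hM : ∀ v, Nonempty (M v).V) (hM' : ∀ v, Nonempty (M' v).V)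
    (e : Iso (P.comp M) (P'.comp M')) :
    ∃ σ : P.V → P'.V, ∀ x : (P.comp M).V, (e.toEquiv x).1 = σ x.1 := by
  have : ∀ v, ∃ i, ∀ x : (P.comp M).V, x.1 = v → (e.toEquiv x).1 = i := by
    intro v
    obtain ⟨m⟩ := hM v
    rcases align hP' h3 hM' _ (module_image e (block_module P M v)) ⟨_, ⟨v, m⟩, rfl, rfl⟩ with
      h | ⟨i, hi⟩
    · exfalso
      have : Nontrivial P.V := Fintype.one_lt_card_iff_nontrivial.1 h2
      obtain ⟨w, hw⟩ := exists_ne v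
      obtain ⟨n⟩ := hM w
      have : e.toEquiv ⟨w, n⟩ ∈ (Set.univ : Set (P'.comp M').V) := trivial
      rw [← h] at this
      obtain ⟨x, hx, hx'⟩ := this
      obtain rfl := e.toEquiv.injective hx'
      exact hw hx
    · exact ⟨i, fun x hx => hi _ ⟨x, hx, rfl⟩⟩
  choose σ hσ using this
  exact ⟨σ, fun x => hσ x.1 x rfl⟩

theorem comp_unique {P P' : LGraph} {M : P.V → LGraph} {M' : P'.V → LGraph}
    (hP : P.Prime) (h4 : 4 ≤ Fintype.card P.V)
    (hP' : P'.Prime) (h4' : 4 ≤ Fintype.card P'.V)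
    (hM : ∀ v, Nonempty (M v).V) (hM' : ∀ v, Nonempty (M' v).V)
    (h : (P.comp M).iso (P'.comp M')) :
    ∃ σ : P.V ≃ P'.V, (∀ v w, P.adj v w ↔ P'.adj (σ v) (σ w)) ∧
      ∀ v, (M v).iso (M' (σ v)) := by
  obtain ⟨e⟩ := h
  have e' : (P'.comp M').iso (P.comp M) := iso_symm ⟨e⟩
  obtain ⟨f, hf⟩ : ∃ f : Iso (P'.comp M') (P.comp M), ∀ x, f.toEquiv x = e.toEquiv.symm x := by
    refine ⟨⟨e.toEquiv.symm, fun v w => ?_, fun v => ?_⟩, fun x => rfl⟩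
    · rw [e.adj_iff, e.toEquiv.apply_symm_apply, e.toEquiv.apply_symm_apply]
    · rw [← e.label_eq, e.toEquiv.apply_symm_apply]
  obtain ⟨σ, hσ⟩ := comp_iso_map hP' (by omega) (by omega) hM hM' e
  obtain ⟨τ, hτ⟩ := comp_iso_map hP (by omega) (by omega) hM' hM f
  have h1 : ∀ v, τ (σ v) = v := by
    intro v
    obtain ⟨m⟩ := hM v
    obtain ⟨z, rfl⟩ : ∃ z : (P.comp M).V, z.1 = v := ⟨⟨v, m⟩, rfl⟩
    have h1 := hσ z
    have h2 := hτ (e.toEquiv z)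
    rw [hf, e.toEquiv.symm_apply_apply, h1] at h2
    exact h2.symm
  have h2 : ∀ v, σ (τ v) = v := by
    intro v
    obtain ⟨m⟩ := hM' v
    obtain ⟨z, rfl⟩ : ∃ z : (P'.comp M').V, z.1 = v := ⟨⟨v, m⟩, rfl⟩
    have h1 := hτ z
    have h2 := hσ (f.toEquiv z)
    rw [h1, hf, e.toEquiv.apply_symm_apply] at h2
    exact h2.symm
  refine ⟨⟨σ, τ, h1, h2⟩, ?_, ?_⟩
  · intro v w
    change _ ↔ P'.adj (σ v) (σ w)
    by_cases hvw : v = w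
    · subst hvw
      exact ⟨fun h => (P.irrefl v h).elim, fun h => (P'.irrefl _ h).elim⟩
    · obtain ⟨a⟩ := hM v
      obtain ⟨b⟩ := hM w
      have hne : σ v ≠ σ w := fun h => hvw (by rw [← h1 v, h, h1])
      obtain ⟨x, rfl⟩ : ∃ z : (P.comp M).V, z.1 = v := ⟨⟨v, a⟩, rfl⟩
      obtain ⟨y, rfl⟩ : ∃ z : (P.comp M).V, z.1 = w := ⟨⟨w, b⟩, rfl⟩
      have h3 := e.adj_iff x y
      have h4 := comp_adj_ne' P' M' (x := e.toEquiv x) (y := e.toEquiv y)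
        (by rw [hσ, hσ]; exact hne)
      rw [hσ, hσ] at h4
      exact (comp_adj_ne' P M hvw).symm.trans (h3.trans h4)
  · intro v
    refine iso_trans (block_iso P M v) (iso_trans (ind_congr e _ _ ?_)
      (iso_symm (block_iso P' M' (σ v))))
    intro x
    change x.1 = v ↔ (e.toEquiv x).1 = σ v
    rw [hσ]
    exact ⟨fun h => by rw [h], fun h => by rw [← h1 x.1, h, h1]⟩

/-! ### Refinement of joins -/

theorem ind_join (G : LGraph) (b : Prop) (X Y : Set G.V) (hd : Disjoint X Y)
    (h : ∀ x ∈ X, ∀ y ∈ Y, (G.adj x y ↔ b)) :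
    (G.ind (X ∪ Y)).iso (join b (G.ind X) (G.ind Y)) := by
  classical
  refine iso_symm ⟨⟨(Equiv.Set.union hd).symm, ?_, ?_⟩⟩
  · rintro (⟨x, hx⟩ | ⟨x, hx⟩) (⟨y, hy⟩ | ⟨y, hy⟩)
    · rfl
    · exact (h x hx y hy).symm
    · refine (h y hy x hx).symm.trans ?_
      exact ⟨fun h => G.symm h, fun h => G.symm h⟩
    · rfl
  · rintro (⟨x, hx⟩ | ⟨x, hx⟩) <;> rfl

theorem join_left_ind (b : Prop) (A B : LGraph) :
    A.iso ((join b A B).ind {x : A.V ⊕ B.V | x.isLeft = true}) := by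
  refine ⟨⟨⟨fun a => ⟨Sum.inl a, rfl⟩, fun x => Sum.getLeft x.1 x.2, ?_, ?_⟩, ?_, ?_⟩⟩
  · intro a; rfl
  · rintro ⟨x | x, hx⟩
    · rfl
    · cases (show false = true from hx)
  · intro x y; rfl
  · intro x; rfl

theorem join_right_ind (b : Prop) (A B : LGraph) :
    B.iso ((join b A B).ind {x : A.V ⊕ B.V | x.isRight = true}) := by
  refine ⟨⟨⟨fun a => ⟨Sum.inr a, rfl⟩, fun x => Sum.getRight x.1 x.2, ?_, ?_⟩, ?_, ?_⟩⟩
  · intro a; rfl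
  · rintro ⟨x | x, hx⟩
    · cases (show false = true from hx)
    · rfl
  · intro x y; rfl
  · intro x; rfl

theorem join_adj_lr (b : Prop) (A B : LGraph) (x y : (join b A B).V)
    (hx : Sum.isLeft (α := A.V) (β := B.V) x = true)
    (hy : Sum.isRight (α := A.V) (β := B.V) y = true) : (join b A B).adj x y ↔ b := by
  rcases x with x | x
  · rcases y with y | y
    · cases (show false = true from hy)
    · rfl
  · cases (show false = true from hx)

theorem join_refine {b : Prop} {A B A' B' : LGraph} (h : (join b A B).iso (join b A' B')) :
    ∃ A1 A2 B1 B2 : LGraph, A.iso (join b A1 A2) ∧ B.iso (join b B1 B2) ∧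
      A'.iso (join b A1 B1) ∧ B'.iso (join b A2 B2) := by
  obtain ⟨e⟩ := h
  let l : (join b A B).V → Prop := fun x => Sum.isLeft (α := A.V) (β := B.V) x = true
  let r : (join b A B).V → Prop := fun x => Sum.isRight (α := A.V) (β := B.V) x = true
  let l' : (join b A B).V → Prop := fun x =>
    Sum.isLeft (α := A'.V) (β := B'.V) (e.toEquiv x) = true
  let r' : (join b A B).V → Prop := fun x =>
    Sum.isRight (α := A'.V) (β := B'.V) (e.toEquiv x) = true
  have hlr : ∀ x, l x ∨ r x := by
    rintro (x | x)
    · exact Or.inl rfl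
    · exact Or.inr rfl
  have hn : ∀ x, l x → r x → False := by
    rintro (x | x) h1 h2
    · cases h2
    · cases h1
  have hlr0 : ∀ x : A'.V ⊕ B'.V, x.isLeft = true ∨ x.isRight = true := by
    rintro (x | x)
    · exact Or.inl rfl
    · exact Or.inr rfl
  have hn0 : ∀ x : A'.V ⊕ B'.V, x.isLeft = true → x.isRight = true → False := by
    rintro (x | x) h1 h2
    · cases h2
    · cases h1
  have hlr' : ∀ x, l' x ∨ r' x := fun x => hlr0 _
  have hn' : ∀ x, l' x → r' x → False := fun x => hn0 _
  have ha : ∀ x y, l x → r y → ((join b A B).adj x y ↔ b) := fun x y => join_adj_lr b A B x y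
  have ha' : ∀ x y, l' x → r' y → ((join b A B).adj x y ↔ b) := fun x y h1 h2 =>
    (e.adj_iff x y).trans (join_adj_lr b A' B' _ _ h1 h2)
  have key : ∀ (p q q' : (join b A B).V → Prop), (∀ x, q x ∨ q' x) → (∀ x, q x → q' x → False) →
      (∀ x y, q x → q' y → ((join b A B).adj x y ↔ b)) →
      ((join b A B).ind {x | p x}).iso
        (join b ((join b A B).ind {x | p x ∧ q x}) ((join b A B).ind {x | p x ∧ q' x})) := by
    intro p q q' h1 h2 h3
    have : {x | p x} = {x | p x ∧ q x} ∪ {x | p x ∧ q' x} := by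
      ext x
      have := h1 x
      simp only [Set.mem_setOf_eq, Set.mem_union]
      tauto
    rw [this]
    apply ind_join
    · rw [Set.disjoint_left]
      intro x hx hx'
      exact h2 x hx.2 hx'.2
    · intro x hx y hy
      exact h3 x y hx.2 hy.2
  have sw : ∀ p q : (join b A B).V → Prop, {x | p x ∧ q x} = {x | q x ∧ p x} := by
    intro p q; ext x; exact and_comm
  refine ⟨(join b A B).ind {x | l x ∧ l' x}, (join b A B).ind {x | l x ∧ r' x},
    (join b A B).ind {x | r x ∧ l' x}, (join b A B).ind {x | r x ∧ r' x}, ?_, ?_, ?_, ?_⟩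
  · exact iso_trans (join_left_ind b A B) (key l l' r' hlr' hn' ha')
  · exact iso_trans (join_right_ind b A B) (key r l' r' hlr' hn' ha')
  · refine iso_trans (join_left_ind b A' B') (iso_trans (iso_symm (ind_congr e {x | l' x} _
      (fun v => Iff.rfl))) ?_)
    rw [sw l l', sw r l']
    exact key l' l r hlr hn ha
  · refine iso_trans (join_right_ind b A' B') (iso_trans (iso_symm (ind_congr e {x | r' x} _
      (fun v => Iff.rfl))) ?_)
    rw [sw l r', sw r r']
    exact key r' l r hlr hn ha

end LGraph

/-! ## Decomposition of contexts -/

namespace LGraph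

theorem not_prime_three {P : LGraph} (hP : P.Prime) : Fintype.card P.V ≠ 3 := by
  classical
  intro h3
  have h3' : (Finset.univ : Finset P.V).card = 3 := h3
  obtain ⟨x, y, z, hxy, hxz, hyz, hall⟩ := Finset.card_eq_three.1 h3'
  have hall' : ∀ v : P.V, v = x ∨ v = y ∨ v = z := by
    intro v
    have : v ∈ (Finset.univ : Finset P.V) := Finset.mem_univ v
    rw [hall] at this
    simpa using this
  have key : ∀ a b c : P.V, a ≠ b → a ≠ c → b ≠ c → (∀ v, v = a ∨ v = b ∨ v = c) →
      (P.adj c a ↔ P.adj c b) → False := by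
    intro a b c hab hac hbc hv h
    have hm : P.IsModule {a, b} := by
      intro v hv' p hp q hq
      have : v = c := by
        rcases hv v with h | h | h
        · exact (hv' (Or.inl h)).elim
        · exact (hv' (Or.inr h)).elim
        · exact h
      subst this
      rcases hp with hp | hp <;> rcases hq with hq | hq <;> cases hp <;> cases hq
      · exact Iff.rfl
      · exact h
      · exact h.symm
      · exact Iff.rfl
    rcases hP.2 _ hm with h | ⟨i, h⟩ | h
    · have : a ∈ (∅ : Set P.V) := by rw [← h]; exact Or.inl rfl
      exact this
    · have h1 : a ∈ ({i} : Set P.V) := by rw [← h]; exact Or.inl rfl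
      have h2 : b ∈ ({i} : Set P.V) := by rw [← h]; exact Or.inr rfl
      exact hab (Eq.trans h1 (Eq.symm h2))
    · have : c ∈ ({a, b} : Set P.V) := by rw [h]; trivial
      rcases this with h | h
      · exact hac h.symm
      · exact hbc h.symm
  have s : ∀ a b, P.adj a b ↔ P.adj b a := fun a b => ⟨fun h => P.symm h, fun h => P.symm h⟩
  have k1 := key x y z hxy hxz hyz hall'
  have k2 := key x z y hxz hxy hyz.symm (fun v => by have := hall' v; tauto)
  have k3 := key y z x hyz hxy.symm hxz.symm (fun v => by have := hall' v; tauto)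
  rw [s z x, s z y] at k1
  rw [s y x] at k2
  tauto

/-- Splitting a context along a set that forms a module together with the hole. -/
theorem ctx_split (C : LGraph) (R T : Set C.V)
    (h : ∀ v ∉ T, ∀ y ∈ T, (C.adj v y ↔ v ∈ R)) (X : LGraph) :
    (C.plug R X).iso ((C.ind Tᶜ).plug {v | v.1 ∈ R} ((C.ind T).plug {v | v.1 ∈ R} X)) := by
  classical
  refine iso_trans (iso_symm ?_) (iso_symm (plug_plug _ _ _ _ _))
  refine plug_congr (S := R) ?_ (iso_refl X)
  refine ⟨⟨(Equiv.sumComm _ _).trans (Equiv.Set.sumCompl T), ?_, ?_⟩, ?_⟩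
  · rintro (a | a) (b | b)
    · rfl
    · exact (h a.1 a.2 b.1 b.2).symm
    · refine Iff.trans (h b.1 b.2 a.1 a.2).symm ?_
      exact ⟨fun h => C.symm h, fun h => C.symm h⟩
    · rfl
  · rintro (a | a) <;> rfl
  · rintro (a | a) <;> rfl

/-- Sets of vertices that form a module of any filling of the context. -/
def Good (C : LGraph) (R S : Set C.V) : Prop :=
  C.IsModule S ∧ ∀ x ∈ S, ∀ y ∈ S, (x ∈ R ↔ y ∈ R)

/-- Vertices in a common good set. -/
def goodSetoid (C : LGraph) (R : Set C.V) : Setoid C.V where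
  r u v := ∃ S, Good C R S ∧ u ∈ S ∧ v ∈ S
  iseqv := by
    refine ⟨fun u => ⟨{u}, ⟨?_, ?_⟩, rfl, rfl⟩, ?_, ?_⟩
    · rintro v hv x rfl y rfl; exact Iff.rfl
    · rintro x rfl y rfl; exact Iff.rfl
    · rintro x y ⟨S, hS, hx, hy⟩; exact ⟨S, hS, hy, hx⟩
    · rintro x y z ⟨S, hS, hx, hy⟩ ⟨S', hS', hy', hz⟩
      refine ⟨S ∪ S', ⟨?_, ?_⟩, Or.inl hx, Or.inr hz⟩
      · intro v hv
        have key : ∀ p ∈ S ∪ S', (C.adj v p ↔ C.adj v y) := by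
          rintro p (hp | hp)
          · exact hS.1 v (fun h => hv (Or.inl h)) p hp y hy
          · exact hS'.1 v (fun h => hv (Or.inr h)) p hp y hy'
        intro p hp q hq
        exact (key p hp).trans (key q hq).symm
      · have key : ∀ p ∈ S ∪ S', (p ∈ R ↔ y ∈ R) := by
          rintro p (hp | hp)
          · exact hS.2 p hp y hy
          · exact hS'.2 p hp y hy'
        intro p hp q hq
        exact (key p hp).trans (key q hq).symm

theorem good_adj {C : LGraph} {R : Set C.V} {u u' v : C.V} (h : goodSetoid C R u u')
    (hv : ¬ goodSetoid C R u v) : C.adj v u ↔ C.adj v u' := by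
  obtain ⟨S, hS, hu, hu'⟩ := h
  exact hS.1 v (fun h => hv ⟨S, hS, hu, h⟩) u hu u' hu'

theorem good_mem {C : LGraph} {R : Set C.V} {u u' : C.V} (h : goodSetoid C R u u') :
    u ∈ R ↔ u' ∈ R := by
  obtain ⟨S, hS, hu, hu'⟩ := h
  exact hS.2 u hu u' hu'

/-- Adjacency of the quotient of a context. -/
def quotAdj (C : LGraph) (R : Set C.V) :
    Option (Quotient (goodSetoid C R)) → Option (Quotient (goodSetoid C R)) → Prop
  | none, none => False
  | some p, none => p.out ∈ R
  | none, some p => p.out ∈ R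
  | some p, some q => C.adj p.out q.out

open Classical in
/-- The quotient graph of a context, with the hole as the vertex `none`. -/
noncomputable def quotGraph (C : LGraph) (R : Set C.V) : LGraph where
  V := Option (Quotient (goodSetoid C R))
  fintype := Fintype.ofFinite _
  adj := quotAdj C R
  symm := by
    rintro (_ | p) (_ | q) h
    · exact h
    · exact h
    · exact h
    · exact C.symm h
  irrefl := by
    rintro (_ | p) h
    · exact h
    · exact C.irrefl _ h
  label _ := (0, true)

theorem quot_out_rel (C : LGraph) (R : Set C.V) (u : C.V) :
    goodSetoid C R (Quotient.mk (goodSetoid C R) u).out u :=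
  Quotient.exact (Quotient.out_eq _)

theorem quot_adj {C : LGraph} {R : Set C.V} {u v : C.V} (h : ¬ goodSetoid C R u v) :
    quotAdj C R (some (Quotient.mk _ u)) (some (Quotient.mk _ v)) ↔ C.adj u v := by
  change C.adj _ _ ↔ _
  have hu := quot_out_rel C R u
  have hv := quot_out_rel C R v
  have hs : ∀ a b, C.adj a b ↔ C.adj b a := fun a b => ⟨fun h => C.symm h, fun h => C.symm h⟩
  have h1 := good_adj (v := (Quotient.mk (goodSetoid C R) u).out) hv (fun h' =>
    h ((goodSetoid C R).symm ((goodSetoid C R).trans ((goodSetoid C R).symm hv)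
      ((goodSetoid C R).trans h' hu))))
  have h2 := good_adj (v := v) hu (fun h' => h ((goodSetoid C R).trans
      ((goodSetoid C R).symm hu) h'))
  rw [h1, hs _ v, h2, hs]

theorem quot_hole {C : LGraph} {R : Set C.V} {u : C.V} :
    (Quotient.mk (goodSetoid C R) u).out ∈ R ↔ u ∈ R := good_mem (quot_out_rel C R u)

/-- The blocks of the quotient of a context. -/
noncomputable def quotBlock (C : LGraph) (R : Set C.V) (X : LGraph) :
    (quotGraph C R).V → LGraph
  | none => X
  | some p => C.ind {u | Quotient.mk (goodSetoid C R) u = p}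

theorem quot_iso (C : LGraph) (R : Set C.V) (X : LGraph) :
    (C.plug R X).iso ((quotGraph C R).comp (quotBlock C R X)) := by
  refine ⟨⟨⟨fun x => match x with
      | .inl u => ⟨some (Quotient.mk _ u), ⟨u, rfl⟩⟩
      | .inr x => ⟨none, x⟩,
    fun x => match x with
      | ⟨some _, u⟩ => .inl u.1
      | ⟨none, x⟩ => .inr x, ?_, ?_⟩, ?_, ?_⟩⟩
  · rintro (u | u) <;> rfl
  · rintro ⟨_ | p, u⟩
    · rfl
    · obtain ⟨u, rfl⟩ := u
      rfl
  · rintro (u | u) (v | v)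
    · by_cases h : goodSetoid C R u v
      · have h' : Quotient.mk (goodSetoid C R) u = Quotient.mk (goodSetoid C R) v :=
          Quotient.sound h
        have key : ∀ (p : Quotient (goodSetoid C R)) (hu : Quotient.mk (goodSetoid C R) u = p)
            (hv : Quotient.mk (goodSetoid C R) v = p), C.adj u v ↔
            ((quotGraph C R).comp (quotBlock C R X)).adj
              ⟨some (Quotient.mk _ u), ⟨u, rfl⟩⟩ ⟨some (Quotient.mk _ v), ⟨v, rfl⟩⟩ := by
          intro p hu hv
          have e1 : (⟨some (Quotient.mk _ u), ⟨u, rfl⟩⟩ :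
              ((quotGraph C R).comp (quotBlock C R X)).V) = ⟨some p, ⟨u, hu⟩⟩ := by
            cases hu; rfl
          have e2 : (⟨some (Quotient.mk _ v), ⟨v, rfl⟩⟩ :
              ((quotGraph C R).comp (quotBlock C R X)).V) = ⟨some p, ⟨v, hv⟩⟩ := by
            cases hv; rfl
          rw [e1, e2]
          exact (comp_adj_same (quotGraph C R) (quotBlock C R X) (some p) ⟨u, hu⟩ ⟨v, hv⟩).symm
        exact key _ rfl h'.symm
      · refine Iff.trans (quot_adj h).symm ?_
        exact (comp_adj_ne (quotGraph C R) (quotBlock C R X)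
          (v := some (Quotient.mk _ u)) (w := some (Quotient.mk _ v))
          (fun h' => h (Quotient.exact (Option.some.inj h'))) ⟨u, rfl⟩ ⟨v, rfl⟩).symm
    · refine Iff.trans quot_hole.symm ?_
      exact (comp_adj_ne (quotGraph C R) (quotBlock C R X)
          (v := some (Quotient.mk _ u)) (w := none) (fun h' => by cases h') ⟨u, rfl⟩ v).symm
    · refine Iff.trans quot_hole.symm ?_
      exact (comp_adj_ne (quotGraph C R) (quotBlock C R X)
          (v := none) (w := some (Quotient.mk _ v)) (fun h' => by cases h') u ⟨v, rfl⟩).symm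
    · exact (comp_adj_same (quotGraph C R) (quotBlock C R X) none u v).symm
  · rintro (u | u) <;> rfl

theorem quot_prime (C : LGraph) (R : Set C.V) (hC : Nonempty C.V)
    (ha : ∀ T : Set C.V, (∀ v ∉ T, ∀ y ∈ T, (C.adj v y ↔ v ∈ R)) → T = ∅ ∨ T = Set.univ) :
    (quotGraph C R).Prime := by
  constructor
  · obtain ⟨u⟩ := hC
    have : Nontrivial (quotGraph C R).V :=
      ⟨⟨none, some (Quotient.mk _ u), fun h => by cases h⟩⟩
    exact Fintype.one_lt_card_iff_nontrivial.2 this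
  · intro M hM
    by_cases hn : (none : (quotGraph C R).V) ∈ M
    · right
      have hT : ∀ v ∉ {u | (some (Quotient.mk _ u) : (quotGraph C R).V) ∈ M},
          ∀ y ∈ {u | (some (Quotient.mk _ u) : (quotGraph C R).V) ∈ M},
          (C.adj v y ↔ v ∈ R) := by
        intro v hv y hy
        have h1 := hM _ hv _ hy _ hn
        have h2 : ¬ goodSetoid C R v y := fun h => hv (by
          have : Quotient.mk (goodSetoid C R) v = Quotient.mk (goodSetoid C R) y :=
            Quotient.sound h
          change (some (Quotient.mk (goodSetoid C R) v) : (quotGraph C R).V) ∈ M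
          rw [this]; exact hy)
        exact (quot_adj h2).symm.trans (h1.trans quot_hole)
      rcases ha _ hT with h | h
      · left
        refine ⟨none, ?_⟩
        ext p
        constructor
        · intro hp
          rcases p with _ | p
          · rfl
          · exfalso
            obtain ⟨u, rfl⟩ := Quotient.exists_rep p
            have : u ∈ (∅ : Set C.V) := by rw [← h]; exact hp
            exact this
        · rintro rfl; exact hn
      · right
        ext p
        refine ⟨fun _ => trivial, fun _ => ?_⟩
        rcases p with _ | p
        · exact hn
        · obtain ⟨u, rfl⟩ := Quotient.exists_rep p
          have : u ∈ (Set.univ : Set C.V) := trivial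
          rw [← h] at this
          exact this
    · have hg : Good C R {u | (some (Quotient.mk _ u) : (quotGraph C R).V) ∈ M} := by
        constructor
        · intro v hv x hx y hy
          have h1 := hM _ hv _ hx _ hy
          have h2 : ∀ z, (some (Quotient.mk (goodSetoid C R) z) : (quotGraph C R).V) ∈ M →
              ¬ goodSetoid C R v z := fun z hz h => hv (by
            have : Quotient.mk (goodSetoid C R) v = Quotient.mk (goodSetoid C R) z :=
              Quotient.sound h
            change (some (Quotient.mk (goodSetoid C R) v) : (quotGraph C R).V) ∈ M
            rw [this]; exact hz)
          exact (quot_adj (h2 x hx)).symm.trans (h1.trans (quot_adj (h2 y hy)))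
        · intro x hx y hy
          have h1 := hM _ hn _ hx _ hy
          exact quot_hole.symm.trans (h1.trans quot_hole)
      by_cases hM0 : M = ∅
      · exact Or.inl hM0
      · right; left
        obtain ⟨q, hq⟩ := Set.nonempty_iff_ne_empty.2 hM0
        refine ⟨q, Set.eq_singleton_iff_unique_mem.2 ⟨hq, fun p hp => ?_⟩⟩
        rcases q with _ | q
        · exact (hn hq).elim
        rcases p with _ | p
        · exact (hn hp).elim
        obtain ⟨u, rfl⟩ := Quotient.exists_rep p
        obtain ⟨v, rfl⟩ := Quotient.exists_rep q
        exact congrArg some (Quotient.sound ⟨_, hg, hp, hq⟩)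

open Classical in
/-- Decomposition of contexts. -/
theorem ctx_cases (C : LGraph) (R : Set C.V) (hC : Nonempty C.V) :
    (∃ (E : LGraph) (S : Set E.V) (D : LGraph) (T : Set D.V), Nonempty E.V ∧ Nonempty D.V ∧
      Fintype.card E.V + Fintype.card D.V = Fintype.card C.V ∧
      ∀ X, (C.plug R X).iso (E.plug S (D.plug T X))) ∨
    (∃ b : Prop, R = {_v | b}) ∨
    (∃ (P : LGraph) (i : P.V) (M : P.V → LGraph), P.Prime ∧ 4 ≤ Fintype.card P.V ∧
      (∀ w, w ≠ i → Nonempty (M w).V) ∧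
      ∀ X, (C.plug R X).iso (P.comp (Function.update M i X))) := by
  by_cases ha : ∀ T : Set C.V, (∀ v ∉ T, ∀ y ∈ T, (C.adj v y ↔ v ∈ R)) → T = ∅ ∨ T = Set.univ
  · right
    by_cases hb : ∃ b : Prop, R = {_v | b}
    · exact Or.inl hb
    right
    have hP := quot_prime C R hC ha
    refine ⟨quotGraph C R, none, quotBlock C R LGraph.empty, hP, ?_, ?_, ?_⟩
    · have h2 := hP.1
      have h3 := not_prime_three hP
      have h2' : Fintype.card (quotGraph C R).V ≠ 2 := by
        intro h2'
        apply hb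
        obtain ⟨u⟩ := hC
        refine ⟨u ∈ R, ?_⟩
        ext v
        have huv : goodSetoid C R u v := by
          by_contra huv
          have : ({none, some (Quotient.mk _ u), some (Quotient.mk _ v)} :
              Finset (quotGraph C R).V).card = 3 := by
            rw [Finset.card_eq_three]
            refine ⟨_, _, _, ?_, ?_, ?_, rfl⟩
            · intro h; cases h
            · intro h; cases h
            · intro h; exact huv (Quotient.exact (Option.some.inj h))
          have h4 := Finset.card_le_univ ({none, some (Quotient.mk _ u), some (Quotient.mk _ v)} :
              Finset (quotGraph C R).V)
          omega
        exact (good_mem huv).symm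
      omega
    · intro w hw
      rcases w with _ | w
      · exact (hw rfl).elim
      · obtain ⟨u, rfl⟩ := Quotient.exists_rep w
        exact ⟨⟨u, rfl⟩⟩
    · intro X
      have : Function.update (quotBlock C R LGraph.empty) none X = quotBlock C R X := by
        funext w
        rcases w with _ | w
        · exact Function.update_self _ _ _
        · exact Function.update_of_ne (fun h => by cases h) _ _
      refine iso_trans (quot_iso C R X) ?_
      rw [← this]
      exact iso_refl _
  · left
    push Not at ha
    obtain ⟨T, hT, h1, h2⟩ := ha
    obtain ⟨u, hu⟩ := h1
    obtain ⟨v, hv⟩ := (Set.ne_univ_iff_exists_notMem T).1 h2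
    exact ⟨C.ind Tᶜ, _, C.ind T, _, ⟨⟨v, hv⟩⟩, ⟨⟨u, hu⟩⟩, card_ind_compl C T,
      ctx_split C R T hT⟩

end LGraph

/-! ## Cardinalities of compositions -/

namespace LGraph

open Classical in
theorem card_comp_hole (P : LGraph) (i : P.V) (M : P.V → LGraph) :
    Fintype.card (P.comp M).V =
      Fintype.card (P.comp (Function.update M i LGraph.empty)).V + Fintype.card (M i).V := by
  rw [iso_card (comp_hole P i M M (fun w _ => iso_refl _)), card_plug]

open Classical in
theorem card_comp_update (P : LGraph) (i : P.V) (M : P.V → LGraph) (X : LGraph) :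
    Fintype.card (P.comp (Function.update M i X)).V =
      Fintype.card (P.comp (Function.update M i LGraph.empty)).V + Fintype.card X.V := by
  rw [card_comp_hole P i (Function.update M i X)]
  simp

open Classical in
theorem card_update_lt (P : LGraph) (i : P.V) (M : P.V → LGraph) (h : Nonempty (M i).V) :
    Fintype.card (P.comp (Function.update M i LGraph.empty)).V < Fintype.card (P.comp M).V := by
  rw [card_comp_hole P i M]
  have := Fintype.card_pos_iff.2 h
  omega

theorem card_block_lt (P : LGraph) (h2 : 2 ≤ Fintype.card P.V) (i : P.V) (M : P.V → LGraph)
    (h : ∀ w, w ≠ i → Nonempty (M w).V) :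
    Fintype.card (M i).V < Fintype.card (P.comp M).V := by
  classical
  rw [card_comp_hole P i M]
  have : Nontrivial P.V := Fintype.one_lt_card_iff_nontrivial.1 h2
  obtain ⟨w, hw⟩ := exists_ne i
  have h1 : Nonempty (P.comp (Function.update M i LGraph.empty)).V := by
    obtain ⟨a⟩ := h w hw
    refine ⟨⟨w, ?_⟩⟩
    rw [Function.update_of_ne hw]
    exact a
  have := Fintype.card_pos_iff.2 h1
  omega

theorem card_block_le (P : LGraph) (i : P.V) (M : P.V → LGraph) :
    Fintype.card (M i).V ≤ Fintype.card (P.comp M).V := by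
  classical
  rw [card_comp_hole P i M]
  omega

theorem card_pos {G : LGraph} (h : Nonempty G.V) : 0 < Fintype.card G.V :=
  Fintype.card_pos_iff.2 h

theorem nonempty_of_card {G : LGraph} (h : Fintype.card G.V ≠ 0) : Nonempty G.V :=
  Fintype.card_pos_iff.1 (Nat.pos_of_ne_zero h)

theorem isEmpty_of_card {G : LGraph} (h : Fintype.card G.V = 0) : IsEmpty G.V :=
  Fintype.card_eq_zero_iff.1 h

theorem card_of_isEmpty {G : LGraph} (h : IsEmpty G.V) : Fintype.card G.V = 0 :=
  Fintype.card_eq_zero_iff.2 h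

theorem card_single (a : Atom) : Fintype.card (single a).V = 1 := rfl

theorem card_empty : Fintype.card LGraph.empty.V = 0 := rfl

/-- Decomposability as a join. -/
def IsJoin (b : Prop) (G : LGraph) : Prop :=
  ∃ A B : LGraph, Nonempty A.V ∧ Nonempty B.V ∧ G.iso (join b A B)

/-- Decomposability along a prime graph. -/
def IsComp (G : LGraph) : Prop :=
  ∃ (P : LGraph) (M : P.V → LGraph), P.Prime ∧ 4 ≤ Fintype.card P.V ∧
    (∀ v, Nonempty (M v).V) ∧ G.iso (P.comp M)

theorem IsJoin.card {b : Prop} {G : LGraph} (h : IsJoin b G) : 2 ≤ Fintype.card G.V := by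
  obtain ⟨A, B, hA, hB, h⟩ := h
  rw [iso_card h, card_join]
  have := card_pos hA
  have := card_pos hB
  omega

theorem IsComp.card {G : LGraph} (h : IsComp G) : 2 ≤ Fintype.card G.V := by
  obtain ⟨P, M, hP, h4, hM, h⟩ := h
  rw [iso_card h]
  have : Nonempty P.V := Fintype.card_pos_iff.1 (by omega)
  obtain ⟨i⟩ := this
  have h1 := card_block_lt P (by omega) i M (fun w _ => hM w)
  have h2 := card_pos (hM i)
  omega

theorem IsJoin.not_isComp {b : Prop} {G : LGraph} (h : IsJoin b G) (h' : IsComp G) : False := by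
  obtain ⟨A, B, hA, hB, h⟩ := h
  obtain ⟨P, M, hP, h4, hM, h'⟩ := h'
  exact join_not_prime b hA hB hP (by omega) hM (iso_trans (iso_symm h) h')

theorem IsJoin.not_both {G : LGraph} (h : IsJoin False G) (h' : IsJoin True G) : False := by
  obtain ⟨A, B, hA, hB, h⟩ := h
  obtain ⟨A', B', hA', hB', h'⟩ := h'
  exact join_false_true hA hB hA' hB' (iso_trans (iso_symm h) h')

end LGraph

/-! ## The interpretation -/

open Classical in
/-- The interpretation of a graph as an upward closed set of isomorphism classes. -/
def NN (G : LGraph) (l : GG) : Prop :=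
  (Fintype.card G.V = 0 ∧ 1 ≤ l) ∨
  (Fintype.card G.V = 1 ∧ gm G ≤ l) ∨
  (∃ (A B : LGraph) (_ : Fintype.card A.V < Fintype.card G.V)
      (_ : Fintype.card B.V < Fintype.card G.V),
    Nonempty A.V ∧ Nonempty B.V ∧ G.iso (join False A B) ∧
      ∃ x y, NN A x ∧ NN B y ∧ x * y ≤ l) ∨
  (IsJoin True G ∧ ∀ (A B : LGraph) (_ : Fintype.card A.dual.V < Fintype.card G.V)
      (_ : Fintype.card B.V < Fintype.card G.V),
      Nonempty A.V → Nonempty B.V → G.iso (join True A B) → ∀ k, NN A.dual k → NN B (l * k)) ∨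
  (∃ (P : LGraph) (M : P.V → LGraph) (_ : ∀ v, Fintype.card (M v).V < Fintype.card G.V),
    P.Prime ∧ 4 ≤ Fintype.card P.V ∧ (∀ v, Nonempty (M v).V) ∧ G.iso (P.comp M) ∧
    ((∃ L : P.V → LGraph, (∀ v, Nonempty (L v).V) ∧ (∀ v, NN (M v) (gm (L v))) ∧
        gm (P.comp L) ≤ l) ∨
     (∃ (w : P.V) (_ : Fintype.card (P.comp (Function.update M w LGraph.empty)).V <
          Fintype.card G.V) (x y : GG),
        NN (M w) x ∧ NN (P.comp (Function.update M w LGraph.empty)) y ∧ x * y ≤ l)))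
termination_by Fintype.card G.V
decreasing_by
  all_goals first | assumption | (rename_i h; exact h _) | (rename_i h _; exact h _)

theorem NN_iso {G H : LGraph} (h : G.iso H) {l : GG} (hG : NN G l) : NN H l := by
  have hc := iso_card h
  have hs := iso_symm h
  rw [NN] at hG ⊢
  rw [hc] at hG
  rw [gm_eq h] at hG
  refine hG.imp id (Or.imp id (Or.imp ?_ (Or.imp ?_ ?_)))
  · rintro ⟨A, B, h1, h2, h3, h4, h5, h6⟩
    exact ⟨A, B, h1, h2, h3, h4, iso_trans hs h5, h6⟩
  · rintro ⟨⟨A, B, h1, h2, h3⟩, h4⟩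
    exact ⟨⟨A, B, h1, h2, iso_trans hs h3⟩, fun A B h1 h2 h3 h5 h6 =>
      h4 A B h1 h2 h3 h5 (iso_trans h h6)⟩
  · rintro ⟨P, M, h1, h2, h3, h4, h5, h6⟩
    exact ⟨P, M, h1, h2, h3, h4, iso_trans hs h5, h6⟩

theorem NN_mono {G : LGraph} {l l' : GG} (hl : l ≤ l') (hG : NN G l) : NN G l' := by
  induction hn : Fintype.card G.V using Nat.strong_induction_on generalizing G l l' with
  | _ n ih =>
    rw [NN] at hG ⊢
    refine hG.imp ?_ (Or.imp ?_ (Or.imp ?_ (Or.imp ?_ ?_)))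
    · exact fun h => ⟨h.1, h.2.trans hl⟩
    · exact fun h => ⟨h.1, h.2.trans hl⟩
    · rintro ⟨A, B, h1, h2, h3, h4, h5, x, y, hx, hy, hxy⟩
      exact ⟨A, B, h1, h2, h3, h4, h5, x, y, hx, hy, hxy.trans hl⟩
    · rintro ⟨h0, h4⟩
      refine ⟨h0, fun A B h1 h2 h3 h5 h6 k hk => ?_⟩
      exact ih _ (hn ▸ h2) (mul_le_mul_left hl k) (h4 A B h1 h2 h3 h5 h6 k hk) rfl
    · rintro ⟨P, M, h1, h2, h3, h4, h5, h6⟩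
      refine ⟨P, M, h1, h2, h3, h4, h5, h6.imp ?_ ?_⟩
      · rintro ⟨L, hL, hL', h⟩
        exact ⟨L, hL, hL', h.trans hl⟩
      · rintro ⟨w, hw, x, y, hx, hy, hxy⟩
        exact ⟨w, hw, x, y, hx, hy, hxy.trans hl⟩

theorem NN_dd {G : LGraph} {l : GG} : NN G.dual.dual l ↔ NN G l :=
  ⟨NN_iso (dual_dual G), NN_iso (iso_symm (dual_dual G))⟩

theorem NN_isEmpty {G : LGraph} (h : IsEmpty G.V) {l : GG} : NN G l ↔ 1 ≤ l := by
  have hc := card_of_isEmpty h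
  constructor
  · intro h
    rw [NN] at h
    rcases h with h | h | h | h | h
    · exact h.2
    · omega
    · obtain ⟨A, B, h1, _⟩ := h
      omega
    · have := h.1.card
      omega
    · obtain ⟨P, M, h1, h2, h3, h4, h5, h6⟩ := h
      have := IsComp.card ⟨P, M, h2, h3, h4, h5⟩
      omega
  · intro h
    rw [NN]
    exact Or.inl ⟨hc, h⟩

theorem NN_empty {l : GG} : NN LGraph.empty l ↔ 1 ≤ l := NN_isEmpty inferInstance

theorem NN_one {G : LGraph} (hc : Fintype.card G.V = 1) {l : GG} : NN G l ↔ gm G ≤ l := by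
  constructor
  · intro h
    rw [NN] at h
    rcases h with h | h | h | h | h
    · omega
    · exact h.2
    · obtain ⟨A, B, h1, h2, h3, h4, h5, _⟩ := h
      have := IsJoin.card ⟨A, B, h3, h4, h5⟩
      omega
    · have := h.1.card
      omega
    · obtain ⟨P, M, h1, h2, h3, h4, h5, h6⟩ := h
      have := IsComp.card ⟨P, M, h2, h3, h4, h5⟩
      omega
  · intro h
    rw [NN]
    exact Or.inr (Or.inl ⟨hc, h⟩)

theorem NN_par_intro {A B : LGraph} {x y l : GG} (hx : NN A x) (hy : NN B y) (h : x * y ≤ l) :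
    NN (join False A B) l := by
  by_cases hA : Nonempty A.V
  · by_cases hB : Nonempty B.V
    · rw [NN]
      right; right; left
      have h1 := card_join False A B
      have h2 := card_pos hA
      have h3 := card_pos hB
      exact ⟨A, B, by omega, by omega, hA, hB, iso_refl _, x, y, hx, hy, h⟩
    · have hB' := not_nonempty_iff.1 hB
      refine NN_iso (iso_symm (plug_isEmpty A _ B hB')) (NN_mono ?_ hx)
      rw [NN_isEmpty hB'] at hy
      calc x = x * 1 := (mul_one x).symm
        _ ≤ x * y := mul_le_mul_right hy x
        _ ≤ l := h
  · have hA' := not_nonempty_iff.1 hA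
    refine NN_iso (iso_symm (plug_ctx_isEmpty A _ B hA')) (NN_mono ?_ hy)
    rw [NN_isEmpty hA'] at hx
    calc y = 1 * y := (one_mul y).symm
      _ ≤ x * y := mul_le_mul_left hx y
      _ ≤ l := h

theorem NN_par_elim {A B : LGraph} {l : GG} (h : NN (join False A B) l) :
    ∃ x y, NN A x ∧ NN B y ∧ x * y ≤ l := by
  induction hn : Fintype.card A.V + Fintype.card B.V using Nat.strong_induction_on
    generalizing A B l with
  | _ n ih =>
    by_cases hA : Nonempty A.V
    swap
    · have hA' := not_nonempty_iff.1 hA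
      exact ⟨1, l, (NN_isEmpty hA').2 le_rfl, NN_iso (plug_ctx_isEmpty A _ B hA') h,
        (one_mul l).le⟩
    by_cases hB : Nonempty B.V
    swap
    · have hB' := not_nonempty_iff.1 hB
      exact ⟨l, 1, NN_iso (plug_isEmpty A _ B hB') h, (NN_isEmpty hB').2 le_rfl,
        (mul_one l).le⟩
    have hJ : IsJoin False (join False A B) := ⟨A, B, hA, hB, iso_refl _⟩
    have hc := hJ.card
    rw [NN] at h
    rcases h with h | h | h | h | h
    · omega
    · omega
    · obtain ⟨A', B', h1, h2, h3, h4, h5, x, y, hx, hy, hxy⟩ := h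
      obtain ⟨A1, A2, B1, B2, i1, i2, i3, i4⟩ := join_refine h5
      rw [card_join] at h1 h2
      have c3 := iso_card i3
      have c4 := iso_card i4
      rw [card_join] at c3 c4
      obtain ⟨x1, y1, hx1, hy1, hxy1⟩ := ih _ (by omega) (NN_iso i3 hx) rfl
      obtain ⟨x2, y2, hx2, hy2, hxy2⟩ := ih _ (by omega) (NN_iso i4 hy) rfl
      refine ⟨x1 * x2, y1 * y2, NN_iso (iso_symm i1) (NN_par_intro hx1 hx2 le_rfl),
        NN_iso (iso_symm i2) (NN_par_intro hy1 hy2 le_rfl), ?_⟩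
      calc x1 * x2 * (y1 * y2) = (x1 * y1) * (x2 * y2) := mul_mul_mul_comm _ _ _ _
        _ ≤ x * y := mul_le_mul' hxy1 hxy2
        _ ≤ l := hxy
    · exact (hJ.not_both h.1).elim
    · obtain ⟨P, M, h1, h2, h3, h4, h5, h6⟩ := h
      exact (hJ.not_isComp ⟨P, M, h2, h3, h4, h5⟩).elim

/-- Orthogonality of a graph and its dual. -/
def Orth (G : LGraph) : Prop := ∀ l k, NN G l → NN G.dual k → 1 ≤ l * k

theorem Orth.dual {G : LGraph} (h : Orth G) : Orth G.dual := by
  intro l k hl hk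
  rw [mul_comm]
  exact h k l (NN_dd.1 hk) hl

theorem Orth.iso {G H : LGraph} (h : Orth G) (e : G.iso H) : Orth H := by
  intro l k hl hk
  exact h l k (NN_iso (iso_symm e) hl) (NN_iso (dual_congr (iso_symm e)) hk)

theorem orth_single {G : LGraph} (h : Fintype.card G.V = 1) : Orth G := by
  intro l k hl hk
  rw [NN_one h] at hl
  rw [NN_one (G := G.dual) h] at hk
  refine le_trans ?_ (mul_le_mul' hl hk)
  obtain ⟨v, hv⟩ := Fintype.card_eq_one_iff.1 h
  have h1 : G.iso (single (G.label v)) := by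
    refine ⟨⟨⟨fun _ => (), fun _ => v, fun x => (hv x).symm, fun _ => rfl⟩, ?_, ?_⟩⟩
    · intro x y
      obtain rfl := hv x
      obtain rfl := hv y
      exact ⟨fun h => G.irrefl _ h, fun h => h.elim⟩
    · intro x
      obtain rfl := hv x
      rfl
  have h2 : G.dual.iso (single (dualAtom (G.label v))) := by
    refine ⟨⟨⟨fun _ => (), fun _ => v, fun x => (hv x).symm, fun _ => rfl⟩, ?_, ?_⟩⟩
    · intro x y
      obtain rfl := hv x
      obtain rfl := hv y
      exact ⟨fun h => h.1 rfl, fun h => h.elim⟩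
    · intro x
      obtain rfl := hv x
      rfl
  rw [gm_eq h1, gm_eq h2, mul_comm]
  exact gm_ax _

theorem orth_empty {G : LGraph} (h : Fintype.card G.V = 0) : Orth G := by
  intro l k hl hk
  rw [NN_isEmpty (isEmpty_of_card h)] at hl
  rw [NN_isEmpty (G := G.dual) (isEmpty_of_card h)] at hk
  exact one_le_mul hl hk

theorem NN_ten_elim {A B : LGraph} {l : GG} (hA : Orth A)
    (h : NN (join True A B) l) : ∀ k, NN A.dual k → NN B (l * k) := by
  intro k hk
  by_cases hA' : Nonempty A.V
  swap
  · have hA'' := not_nonempty_iff.1 hA'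
    rw [NN_isEmpty (G := A.dual) hA''] at hk
    refine NN_mono ?_ (NN_iso (plug_ctx_isEmpty A _ B hA'') h)
    exact le_mul_of_one_le_right' hk
  by_cases hB' : Nonempty B.V
  swap
  · have hB'' := not_nonempty_iff.1 hB'
    rw [NN_isEmpty hB'']
    exact hA l k (NN_iso (plug_isEmpty A _ B hB'') h) hk
  have hJ : IsJoin True (join True A B) := ⟨A, B, hA', hB', iso_refl _⟩
  have hc := hJ.card
  rw [NN] at h
  rcases h with h | h | h | h | h
  · omega
  · omega
  · obtain ⟨A', B', h1, h2, h3, h4, h5, x, y, hx, hy, hxy⟩ := h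
    exact (IsJoin.not_both ⟨A', B', h3, h4, h5⟩ hJ).elim
  · have c := card_join True A B
    have h1 := card_pos hA'
    have h2 := card_pos hB'
    have e : Fintype.card A.dual.V = Fintype.card A.V := rfl
    exact h.2 A B (by omega) (by omega) hA' hB' (iso_refl _) k hk
  · obtain ⟨P, M, h1, h2, h3, h4, h5, h6⟩ := h
    exact (hJ.not_isComp ⟨P, M, h2, h3, h4, h5⟩).elim

theorem NN_ten_elim' {A B : LGraph} {l : GG} (hB : Orth B)
    (h : NN (join True A B) l) : ∀ k, NN B.dual k → NN A (l * k) :=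
  NN_ten_elim hB (NN_iso (join_comm True A B) h)

theorem NN_ten_intro {A B : LGraph} {l : GG}
    (hO : ∀ G : LGraph, Fintype.card G.V < Fintype.card A.V + Fintype.card B.V → Orth G)
    (h1 : ∀ k, NN A.dual k → NN B (l * k)) (h2 : ∀ k, NN B.dual k → NN A (l * k)) :
    NN (join True A B) l := by
  induction hn : Fintype.card A.V + Fintype.card B.V using Nat.strong_induction_on
    generalizing A B l with
  | _ n ih =>
    by_cases hA : Nonempty A.V
    swap
    · have hA' := not_nonempty_iff.1 hA
      refine NN_iso (iso_symm (plug_ctx_isEmpty A _ B hA')) ?_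
      have := h1 1 ((NN_isEmpty (G := A.dual) hA').2 le_rfl)
      rwa [mul_one] at this
    by_cases hB : Nonempty B.V
    swap
    · have hB' := not_nonempty_iff.1 hB
      refine NN_iso (iso_symm (plug_isEmpty A _ B hB')) ?_
      have := h2 1 ((NN_isEmpty (G := B.dual) hB').2 le_rfl)
      rwa [mul_one] at this
    rw [NN]
    right; right; right; left
    refine ⟨⟨A, B, hA, hB, iso_refl _⟩, ?_⟩
    intro A' B' c1 c2 hA' hB' e k hk
    obtain ⟨A1, A2, B1, B2, i1, i2, i3, i4⟩ := join_refine e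
    rw [card_join] at c1 c2
    have e1 : Fintype.card A'.dual.V = Fintype.card A'.V := rfl
    have d1 := iso_card i1
    have d2 := iso_card i2
    have d3 := iso_card i3
    have d4 := iso_card i4
    have d5 := iso_card e
    have p1 := card_pos hA
    have p2 := card_pos hB
    have p3 := card_pos hA'
    have p4 := card_pos hB'
    rw [card_join] at d1 d2 d3 d4
    rw [card_join, card_join] at d5
    have hk' : NN (join False A1.dual B1.dual) k := by
      have := NN_iso (iso_trans (dual_congr i3) (dual_join True A1 B1)) hk
      rwa [not_true_eq_false] at this
    obtain ⟨k1, k2, hk1, hk2, hk12⟩ := NN_par_elim hk'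
    refine NN_mono (mul_le_mul_right hk12 l) (NN_iso (iso_symm i4) ?_)
    have hAd : ∀ j, NN A2.dual j → NN A.dual (k1 * j) := by
      intro j hj
      refine NN_iso (iso_symm (iso_trans (dual_congr i1) (dual_join True A1 A2))) ?_
      rw [not_true_eq_false]
      exact NN_par_intro hk1 hj le_rfl
    have hBd : ∀ j, NN B2.dual j → NN B.dual (k2 * j) := by
      intro j hj
      refine NN_iso (iso_symm (iso_trans (dual_congr i2) (dual_join True B1 B2))) ?_
      rw [not_true_eq_false]
      exact NN_par_intro hk2 hj le_rfl
    refine ih _ ?_ ?_ ?_ ?_ rfl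
    · omega
    · intro G hG
      exact hO G (by omega)
    · intro j hj
      have := NN_ten_elim (hO B1 (by omega)) (NN_iso i2 (h1 _ (hAd j hj))) k2 hk2
      refine NN_mono (le_of_eq ?_) this
      ac_rfl
    · intro j hj
      have := NN_ten_elim (hO A1 (by omega)) (NN_iso i1 (h2 _ (hBd j hj))) k1 hk1
      refine NN_mono (le_of_eq ?_) this
      ac_rfl

open Classical in
theorem NN_prime_intro {P : LGraph} {M : P.V → LGraph} {l : GG} (hP : P.Prime)
    (h4 : 4 ≤ Fintype.card P.V) (hM : ∀ v, Nonempty (M v).V)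
    (h : (∃ L : P.V → LGraph, (∀ v, Nonempty (L v).V) ∧ (∀ v, NN (M v) (gm (L v))) ∧
        gm (P.comp L) ≤ l) ∨
     (∃ (w : P.V) (x y : GG),
        NN (M w) x ∧ NN (P.comp (Function.update M w LGraph.empty)) y ∧ x * y ≤ l)) :
    NN (P.comp M) l := by
  rw [NN]
  right; right; right; right
  refine ⟨P, M, fun v => card_block_lt P (by omega) v M fun w _ => hM w, hP, h4, hM,
    iso_refl _, h.imp id ?_⟩
  rintro ⟨w, x, y, h⟩
  exact ⟨w, card_update_lt P w M (hM w), x, y, h⟩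

open Classical in
theorem NN_prime_elim {P : LGraph} {M : P.V → LGraph} {l : GG} (hP : P.Prime)
    (h4 : 4 ≤ Fintype.card P.V) (hM : ∀ v, Nonempty (M v).V) (h : NN (P.comp M) l) :
    (∃ L : P.V → LGraph, (∀ v, Nonempty (L v).V) ∧ (∀ v, NN (M v) (gm (L v))) ∧
        gm (P.comp L) ≤ l) ∨
     (∃ (w : P.V) (x y : GG),
        NN (M w) x ∧ NN (P.comp (Function.update M w LGraph.empty)) y ∧ x * y ≤ l) := by
  have hJ : IsComp (P.comp M) := ⟨P, M, hP, h4, hM, iso_refl _⟩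
  have hc := hJ.card
  rw [NN] at h
  rcases h with h | h | h | h | h
  · omega
  · omega
  · obtain ⟨A', B', h1, h2, h3, h4, h5, _⟩ := h
    exact (IsJoin.not_isComp ⟨A', B', h3, h4, h5⟩ hJ).elim
  · exact (h.1.not_isComp hJ).elim
  · obtain ⟨P', M', h1, h2, h3, h5, h6, h7⟩ := h
    obtain ⟨σ, hσ, hMσ⟩ := comp_unique hP h4 h2 h3 hM h5 h6
    refine h7.imp ?_ ?_
    · rintro ⟨L, hL, hL', h⟩
      refine ⟨fun v => L (σ v), fun v => hL _, fun v => NN_iso (iso_symm (hMσ v)) (hL' _), ?_⟩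
      rw [gm_eq (comp_congr (Q := P') (N := L) σ hσ (fun v => iso_refl _))]
      exact h
    · rintro ⟨w, _, x, y, hx, hy, hxy⟩
      refine ⟨σ.symm w, x, y, NN_iso (iso_symm (hMσ _)) (by rwa [σ.apply_symm_apply]),
        NN_iso (iso_symm ?_) hy, hxy⟩
      refine comp_congr σ hσ (fun v => ?_)
      by_cases hv : v = σ.symm w
      · subst hv
        rw [σ.apply_symm_apply, Function.update_self, Function.update_self]
        exact iso_refl _
      · rw [Function.update_of_ne hv, Function.update_of_ne]
        · exact hMσ v
        · intro h; exact hv (by rw [← h, σ.symm_apply_apply])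

/-! ## Transport of compositions -/

namespace LGraph

theorem comp_transport {Q Q' : LGraph} (h : Q.iso Q') :
    ∃ f : Q'.V → Q.V, ∀ M : Q.V → LGraph, (Q.comp M).iso (Q'.comp fun v => M (f v)) := by
  obtain ⟨e, h1, h2⟩ := h
  refine ⟨e.symm, fun M => comp_congr e h1 fun v => ?_⟩
  rw [e.symm_apply_apply]
  exact iso_refl _

theorem split_vertex (Q : LGraph) (x : Q.V) :
    ∃ (C : LGraph) (R : Set C.V) (f : (C.plug R (single (Q.label x))).V → Q.V),
      Fintype.card C.V + 1 = Fintype.card Q.V ∧ f (Sum.inr ()) = x ∧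
      Q.iso (C.plug R (single (Q.label x))) ∧
      ∀ M : Q.V → LGraph,
        (Q.comp M).iso ((C.plug R (single (Q.label x))).comp fun v => M (f v)) := by
  classical
  let C := Q.ind {v | v ≠ x}
  let R : Set C.V := {v | Q.adj v.1 x}
  let f : (C.plug R (single (Q.label x))).V → Q.V := fun v =>
    Sum.elim (fun v : C.V => v.1) (fun _ => x) v
  have hf : Function.Bijective f := by
    constructor
    · rintro (a | a) (b | b) h
      · exact congrArg Sum.inl (Subtype.ext h)
      · exact (a.2 h).elim
      · exact (b.2 h.symm).elim
      · rfl
    · intro v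
      by_cases hv : v = x
      · exact ⟨Sum.inr (), hv.symm⟩
      · exact ⟨Sum.inl ⟨v, hv⟩, rfl⟩
  have hadj : ∀ v w, (C.plug R (single (Q.label x))).adj v w ↔ Q.adj (f v) (f w) := by
    rintro (a | a) (b | b)
    · exact Iff.rfl
    · exact Iff.rfl
    · exact ⟨fun h => Q.symm h, fun h => Q.symm h⟩
    · exact ⟨fun h => h.elim, fun h => (Q.irrefl _ h).elim⟩
  have hi : (C.plug R (single (Q.label x))).iso Q := by
    refine ⟨⟨Equiv.ofBijective f hf, hadj, ?_⟩⟩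
    rintro (a | a) <;> rfl
  refine ⟨C, R, f, ?_, rfl, iso_symm hi, fun M => iso_symm ?_⟩
  · rw [← iso_card hi, card_plug, card_single]
  · exact comp_congr (Equiv.ofBijective f hf) hadj fun v => iso_refl _

theorem plug_single_comp (E : LGraph) (S : Set E.V) (a : Atom) (M : E.V → LGraph) (Z : LGraph) :
    ((E.plug S (single a)).comp fun v => Sum.elim M (fun _ => Z) v).iso
      ((E.comp M).plug {p | p.1 ∈ S} Z) :=
  iso_trans (comp_plug E S (single a) _)
    (plug_congr_right (comp_single (single a) () (fun _ => rfl) _))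

theorem comp_isEmpty {Q : LGraph} (M : Q.V → LGraph) (h : IsEmpty Q.V) :
    IsEmpty (Q.comp M).V := ⟨fun x => h.elim x.1⟩

theorem comp_nonempty {Q : LGraph} {M : Q.V → LGraph} (h : Nonempty Q.V)
    (hM : ∀ v, Nonempty (M v).V) : Nonempty (Q.comp M).V := by
  obtain ⟨v⟩ := h
  obtain ⟨a⟩ := hM v
  exact ⟨⟨v, a⟩⟩

theorem prime_card_le_comp {P : LGraph} {M : P.V → LGraph} (hM : ∀ v, Nonempty (M v).V) :
    Fintype.card P.V ≤ Fintype.card (P.comp M).V := by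
  refine Fintype.card_le_of_injective (fun v => (⟨v, (hM v).some⟩ : (P.comp M).V)) ?_
  intro v w h
  exact congrArg Sigma.fst h

end LGraph

theorem gm_le_plug_mul {C : LGraph} (R : Set C.V) (X : LGraph) {k : GG} (h : 1 ≤ gm C * k) :
    gm X ≤ gm (C.plug R X) * k := by
  obtain ⟨K, rfl⟩ := gm_surj k
  rw [gm_mul, gm_eq (plug_par_left C R X K)]
  rw [gm_mul] at h
  exact gm_le_plug _ X h

theorem gm_le_join_mul {b : Prop} {A B : LGraph} {k : GG} (h : 1 ≤ gm A * k) :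
    gm B ≤ gm (join b A B) * k := gm_le_plug_mul _ B h

theorem gm_le_join_mul' {b : Prop} {A B : LGraph} {k : GG} (h : 1 ≤ gm B * k) :
    gm A ≤ gm (join b A B) * k := by
  rw [gm_eq (join_comm b A B)]
  exact gm_le_plug_mul _ A h

/-! ## The identity lemma -/

theorem NN_comp_join {n : ℕ} (O : ∀ G : LGraph, Fintype.card G.V < n → Orth G) (b : Prop)
    {A B A' B' : LGraph} (hn : Fintype.card A.V + Fintype.card B.V ≤ n)
    (hA : NN A (gm A')) (hB : NN B (gm B')) (nA : Nonempty A.V) (nB : Nonempty B.V) :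
    NN (join b A B) (gm (join b A' B')) := by
  have pA := card_pos nA
  have pB := card_pos nB
  by_cases hb : b
  · obtain rfl : b = True := eq_true hb
    refine NN_ten_intro (fun G hG => O G (by omega)) ?_ ?_
    · intro k hk
      exact NN_mono (gm_le_join_mul (O A (by omega) _ _ hA hk)) hB
    · intro k hk
      exact NN_mono (gm_le_join_mul' (O B (by omega) _ _ hB hk)) hA
  · obtain rfl : b = False := eq_false hb
    exact NN_par_intro hA hB (gm_join_false _ _).ge

theorem Lstar {n : ℕ} (O : ∀ G : LGraph, Fintype.card G.V < n → Orth G) (m : ℕ) :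
    ∀ (Q : LGraph) (M L : Q.V → LGraph),
      Fintype.card Q.V + Fintype.card (Q.comp M).V = m → Fintype.card (Q.comp M).V ≤ n →
      (∀ v, NN (M v) (gm (L v))) → NN (Q.comp M) (gm (Q.comp L)) := by
  classical
  induction m using Nat.strong_induction_on with
  | _ m ih =>
  intro Q M L hm hn hML
  by_cases hQ : Nonempty Q.V
  swap
  · have hQ' := not_nonempty_iff.1 hQ
    rw [NN_isEmpty (comp_isEmpty M hQ'), gm_isEmpty (comp_isEmpty L hQ')]
  by_cases hE : ∃ x, IsEmpty (M x).V
  · obtain ⟨x, hx⟩ := hE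
    obtain ⟨C, R, f, hc, hf, -, hi⟩ := split_vertex Q x
    have i1 : (Q.comp M).iso (C.comp fun v => M (f (Sum.inl v))) := by
      refine iso_trans (hi M) (iso_trans (comp_plug C R _ _) (plug_isEmpty _ _ _ ?_))
      refine ⟨fun y => ?_⟩
      obtain ⟨⟨⟩, y⟩ := y
      have y' : (M (f (Sum.inr ()))).V := y
      rw [hf] at y'
      exact hx.elim y'
    have c1 := iso_card i1
    have h1 := ih _ (by omega) C (fun v => M (f (Sum.inl v))) (fun v => L (f (Sum.inl v))) rfl
      (by omega) (fun v => hML _)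
    refine NN_iso (iso_symm i1) (NN_mono ?_ h1)
    rw [gm_eq (iso_trans (hi L) (comp_plug C R _ _))]
    refine gm_le_plug_of_provable _ _ ?_
    rw [gm_eq (comp_single (single (Q.label x)) () (fun _ => rfl) _), hf]
    exact (NN_isEmpty hx).1 (hML x)
  have hM : ∀ v, Nonempty (M v).V := by
    intro v
    by_contra h
    exact hE ⟨v, not_nonempty_iff.1 h⟩
  obtain ⟨x⟩ := hQ
  obtain ⟨C, R, f, hc, hf, hq, hi⟩ := split_vertex Q x
  by_cases hC : Nonempty C.V
  swap
  · have hx : ∀ w, w = x := by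
      have := card_of_isEmpty (not_nonempty_iff.1 hC)
      have : Fintype.card Q.V = 1 := by omega
      obtain ⟨z, hz⟩ := Fintype.card_eq_one_iff.1 this
      intro w
      rw [hz w, hz x]
    rw [gm_eq (comp_single Q x hx L)]
    exact NN_iso (iso_symm (comp_single Q x hx M)) (hML x)
  have pC := card_pos hC
  rcases ctx_cases C R hC with h | h | h
  · obtain ⟨E, S, D, T, hE, hD, hED, hX⟩ := h
    obtain ⟨g, hg⟩ := comp_transport (iso_trans hq (hX _))
    have pE := card_pos hE
    have pD := card_pos hD
    have i1 := fun M => iso_trans (hg M) (comp_plug E S _ _)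
    have c1 := iso_card (i1 M)
    rw [card_plug] at c1
    have cD := card_plug D T (single (Q.label x))
    rw [card_single] at cD
    have h1 := ih _ (by omega) (D.plug T (single (Q.label x))) (fun v => M (g (Sum.inr v)))
      (fun v => L (g (Sum.inr v))) rfl (by omega) (fun v => hML _)
    have i2 := fun M Z => plug_single_comp E S (Q.label x) M Z
    have c2 := iso_card (i2 (fun v => M (g (Sum.inl v)))
      ((D.plug T (single (Q.label x))).comp (fun v => M (g (Sum.inr v)))))
    rw [card_plug] at c2
    have cE := card_plug E S (single (Q.label x))
    rw [card_single] at cE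
    have h2 := ih _ (by omega) (E.plug S (single (Q.label x)))
      (fun v => Sum.elim (fun v => M (g (Sum.inl v))) (fun _ =>
        ((D.plug T (single (Q.label x))).comp (fun v => M (g (Sum.inr v))))) v)
      (fun v => Sum.elim (fun v => L (g (Sum.inl v))) (fun _ =>
        ((D.plug T (single (Q.label x))).comp (fun v => L (g (Sum.inr v))))) v) rfl
      (by omega) (by
        rintro (v | v)
        · exact hML _
        · exact h1)
    rw [gm_eq (i1 L), ← gm_eq (i2 _ _)]
    exact NN_iso (iso_trans (i2 _ _) (iso_symm (i1 M))) h2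
  · obtain ⟨b, rfl⟩ := h
    have i1 := fun M => iso_trans (hi M) (comp_plug C _ _ _)
    have i2 := fun M : Q.V → LGraph => iso_trans (i1 M)
      (plug_congr_right (comp_single (single (Q.label x)) () (fun _ => rfl) _))
    have c2 := iso_card (i2 M)
    rw [card_plug] at c2
    have h1 := ih _ (by omega) C (fun v => M (f (Sum.inl v))) (fun v => L (f (Sum.inl v))) rfl
      (by omega) (fun v => hML _)
    rw [gm_eq (i2 L)]
    refine NN_iso (iso_symm (i2 M)) ?_
    exact NN_comp_join O b (by omega) h1 (hML _) (comp_nonempty hC fun v => hM _) (hM _)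
  · obtain ⟨P, i, F, hP, h4, hF, hX⟩ := h
    have iF := iso_trans hq (hX _)
    obtain ⟨g, hg⟩ := comp_transport iF
    have i1 := fun M => iso_trans (hg M) (comp_comp P _ _)
    have cF := iso_card iF
    have hN : ∀ v, Nonempty (Function.update F i (single (Q.label x)) v).V := by
      intro v
      by_cases hv : v = i
      · subst hv; rw [Function.update_self]; exact ⟨()⟩
      · rw [Function.update_of_ne hv]; exact hF v hv
    generalize Function.update F i (single (Q.label x)) = N at *
    have hb := fun v => card_block_lt P (by omega) v N (fun w _ => hN w)
    have c1 := iso_card (i1 M)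
    have c3 := prime_card_le_comp hN
    have hM' : ∀ v, Nonempty ((N v).comp fun a => M (g ⟨v, a⟩)).V :=
      fun v => comp_nonempty (hN v) fun a => hM _
    have h1 : ∀ v, NN ((N v).comp fun a => M (g ⟨v, a⟩))
        (gm ((N v).comp fun a => L (g ⟨v, a⟩))) := by
      intro v
      have := hb v
      have := card_block_le P v (fun v => (N v).comp fun a => M (g ⟨v, a⟩))
      exact ih _ (by omega) (N v) _ _ rfl (by omega) (fun _ => hML _)
    rw [gm_eq (i1 L)]
    refine NN_iso (iso_symm (i1 M)) (NN_prime_intro hP h4 hM' ?_)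
    by_cases hL : ∀ v, Nonempty ((N v).comp fun a => L (g ⟨v, a⟩)).V
    · exact Or.inl ⟨_, hL, h1, le_rfl⟩
    · right
      push Not at hL
      obtain ⟨w, hw⟩ := hL
      have hw1 := gm_isEmpty hw
      refine ⟨w, 1, _, hw1 ▸ h1 w, ?_, (one_mul _).le⟩
      have := card_update_lt P w (fun v => (N v).comp fun a => M (g ⟨v, a⟩)) (hM' w)
      refine ih _ (by omega) P _ _ rfl (by omega) ?_
      intro v
      by_cases hv : v = w
      · subst hv
        rw [Function.update_self, NN_empty]
        exact hw1.ge
      · rw [Function.update_of_ne hv]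
        exact h1 v

/-! ## Weighted maps and functoriality of contexts -/

/-- Weighted maps between the interpretations of two graphs. -/
def Hom (k : GG) (A B : LGraph) : Prop :=
  (∀ l, NN A l → NN B (l * k)) ∧ (∀ j, NN B.dual j → NN A.dual (j * k))

theorem Hom.dual {k : GG} {A B : LGraph} (h : Hom k A B) : Hom k B.dual A.dual :=
  ⟨h.2, fun j hj => NN_dd.2 (h.1 j (NN_dd.1 hj))⟩

theorem Hom.iso {k : GG} {A B A' B' : LGraph} (h : Hom k A B) (hA : A.iso A') (hB : B.iso B') :
    Hom k A' B' :=
  ⟨fun l hl => NN_iso hB (h.1 l (NN_iso (iso_symm hA) hl)),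
    fun l hl => NN_iso (dual_congr hA) (h.2 l (NN_iso (dual_congr (iso_symm hB)) hl))⟩

theorem Hom.one_le {k : GG} {A B : LGraph} (h : Hom k A B) (hA : IsEmpty A.V) (hB : IsEmpty B.V) :
    1 ≤ k := by
  have := h.1 1 ((NN_isEmpty hA).2 le_rfl)
  rwa [NN_isEmpty hB, one_mul] at this

theorem hom_empty {k : GG} {E B : LGraph} (hE : IsEmpty E.V) (hO : Orth B) (h : NN B k) :
    Hom k E B := by
  constructor
  · intro l hl
    rw [NN_isEmpty hE] at hl
    refine NN_mono ?_ h
    calc k = 1 * k := (one_mul k).symm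
      _ ≤ l * k := mul_le_mul_left hl k
  · intro j hj
    rw [NN_isEmpty (G := E.dual) hE, mul_comm]
    exact hO k j h hj

theorem Fstar_lift {C : LGraph} {R : Set C.V} {A B : LGraph} {k : GG}
    (h1 : ∀ l, NN (C.plug R A) l → NN (C.plug R B) (l * k))
    (h2 : ∀ l, NN (C.dual.plug Rᶜ B.dual) l → NN (C.dual.plug Rᶜ A.dual) (l * k)) :
    Hom k (C.plug R A) (C.plug R B) :=
  ⟨h1, fun j hj => NN_iso (iso_symm (dual_plug C R A)) (h2 j (NN_iso (dual_plug C R B) hj))⟩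

theorem Fstar_half {n : ℕ} (O : ∀ G : LGraph, Fintype.card G.V < n → Orth G) (c : ℕ) :
    ∀ (C : LGraph) (R : Set C.V) (A B : LGraph) (k : GG), Fintype.card C.V = c →
      Fintype.card C.V + Fintype.card A.V ≤ n → Fintype.card C.V + Fintype.card B.V ≤ n →
      Hom k A B → ∀ l, NN (C.plug R A) l → NN (C.plug R B) (l * k) := by
  classical
  induction c using Nat.strong_induction_on with
  | _ c ih =>
  intro C R A B k hc hA hB hk l hl
  have IH : ∀ (C' : LGraph) (R : Set C'.V) (A B : LGraph) (k : GG),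
      Fintype.card C'.V < Fintype.card C.V →
      Fintype.card C'.V + Fintype.card A.V ≤ n → Fintype.card C'.V + Fintype.card B.V ≤ n →
      Hom k A B → Hom k (C'.plug R A) (C'.plug R B) := by
    intro C' R A B k h1 h2 h3 h4
    exact Fstar_lift (ih _ (hc ▸ h1) C' R A B k rfl h2 h3 h4)
      (ih _ (hc ▸ h1) C'.dual Rᶜ B.dual A.dual k rfl h3 h2 h4.dual)
  by_cases hC : Nonempty C.V
  swap
  · have hC' := not_nonempty_iff.1 hC
    exact NN_iso (iso_symm (plug_ctx_isEmpty C R B hC'))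
      (hk.1 l (NN_iso (plug_ctx_isEmpty C R A hC') hl))
  have pC := card_pos hC
  by_cases hAB : IsEmpty A.V ∧ IsEmpty B.V
  · obtain ⟨eA, eB⟩ := hAB
    refine NN_mono (le_mul_of_one_le_right' (hk.one_le eA eB)) ?_
    exact NN_iso (iso_trans (plug_isEmpty C R A eA) (iso_symm (plug_isEmpty C R B eB))) hl
  have hpos : 0 < Fintype.card A.V + Fintype.card B.V := by
    by_contra h
    exact hAB ⟨isEmpty_of_card (by omega), isEmpty_of_card (by omega)⟩
  rcases ctx_cases C R hC with h | h | h
  · obtain ⟨E, S, D, T, hE, hD, hED, hX⟩ := h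
    have pE := card_pos hE
    have pD := card_pos hD
    have h1 := IH D T A B k (by omega) (by omega) (by omega) hk
    have h2 := IH E S _ _ k (by omega) (by rw [card_plug]; omega) (by rw [card_plug]; omega) h1
    exact NN_iso (iso_symm (hX B)) (h2.1 l (NN_iso (hX A) hl))
  · obtain ⟨b, rfl⟩ := h
    by_cases hb : b
    · obtain rfl : b = True := eq_true hb
      change NN (join True C A) l at hl
      change NN (join True C B) (l * k)
      refine NN_ten_intro (fun G hG => O G (by omega)) ?_ ?_
      · intro j hj
        refine NN_mono (le_of_eq ?_) (hk.1 _ (NN_ten_elim (O C (by omega)) hl j hj))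
        exact mul_right_comm l j k
      · intro j hj
        refine NN_mono (le_of_eq ?_) (NN_ten_elim' (O A (by omega)) hl _ (hk.2 j hj))
        rw [mul_comm j k, mul_assoc]
    · obtain rfl : b = False := eq_false hb
      change NN (join False C A) l at hl
      change NN (join False C B) (l * k)
      obtain ⟨x, y, hx, hy, hxy⟩ := NN_par_elim hl
      refine NN_par_intro hx (hk.1 y hy) ?_
      rw [← mul_assoc]
      exact mul_le_mul_left hxy k
  · obtain ⟨P, i, M, hP, h4, hM, hX⟩ := h
    have cX := fun X => iso_card (hX X)
    have c0 := cX LGraph.empty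
    rw [card_plug, card_empty, add_zero] at c0
    refine NN_iso (iso_symm (hX B)) ?_
    replace hl := NN_iso (hX A) hl
    have hne : ∀ X : LGraph, Nonempty X.V → ∀ v, Nonempty (Function.update M i X v).V := by
      intro X nX v
      by_cases hv : v = i
      · subst hv; rw [Function.update_self]; exact nX
      · rw [Function.update_of_ne hv]; exact hM v hv
    have cA := cX A
    have cB := cX B
    rw [card_plug] at cA cB
    by_cases nA : Nonempty A.V
    swap
    · have eA := not_nonempty_iff.1 nA
      have nB : Nonempty B.V := nonempty_of_card (by have := card_of_isEmpty eA; omega)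
      refine NN_prime_intro hP h4 (hne B nB) (Or.inr ⟨i, k, l, ?_, ?_, (mul_comm k l).le⟩)
      · have := hk.1 1 ((NN_isEmpty eA).2 le_rfl)
        rw [one_mul] at this
        rw [Function.update_self]; exact this
      · rw [Function.update_idem]
        refine NN_iso (comp_congr_right fun v => ?_) hl
        by_cases hv : v = i
        · subst hv
          rw [Function.update_self, Function.update_self]
          exact iso_of_isEmpty eA inferInstance
        · rw [Function.update_of_ne hv, Function.update_of_ne hv]
          exact iso_refl _
    have pA := card_pos nA
    rcases NN_prime_elim hP h4 (hne A nA) hl with h | h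
    · obtain ⟨L, hL, hL', hLl⟩ := h
      obtain ⟨K, rfl⟩ := gm_surj k
      refine NN_mono ((comp_update_mul_le P i L K).trans (mul_le_mul_left hLl _)) ?_
      refine Lstar O _ P _ _ rfl (by omega) ?_
      intro v
      have hv' := hL' v
      by_cases hv : v = i
      · subst hv
        rw [Function.update_self] at hv' ⊢
        rw [Function.update_self]
        exact hk.1 _ hv'
      · rw [Function.update_of_ne hv] at hv' ⊢
        rw [Function.update_of_ne hv]
        exact hv'
    · obtain ⟨w, x, y, hx, hy, hxy⟩ := h
      by_cases hw : w = i
      · subst hw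
        rw [Function.update_self] at hx
        rw [Function.update_idem] at hy
        have hx' := hk.1 x hx
        have hxy' : x * k * y ≤ l * k := by
          rw [mul_right_comm]
          exact mul_le_mul_left hxy k
        by_cases nB : Nonempty B.V
        · refine NN_prime_intro hP h4 (hne B nB) (Or.inr ⟨w, x * k, y, ?_, ?_, hxy'⟩)
          · rw [Function.update_self]; exact hx'
          · rw [Function.update_idem]; exact hy
        · have eB := not_nonempty_iff.1 nB
          rw [NN_isEmpty eB] at hx'
          refine NN_mono ?_ (NN_iso (comp_congr_right fun v => ?_) hy) (l := y)
          · exact (le_mul_of_one_le_left' hx').trans hxy'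
          · by_cases hv : v = w
            · subst hv
              rw [Function.update_self, Function.update_self]
              exact iso_of_isEmpty inferInstance eB
            · rw [Function.update_of_ne hv, Function.update_of_ne hv]
              exact iso_refl _
      · rw [Function.update_of_ne hw] at hx
        have cw : ∀ X : LGraph, Fintype.card (P.comp (Function.update M i X)).V =
            Fintype.card (P.comp (Function.update (Function.update M i X) w LGraph.empty)).V +
              Fintype.card (M w).V := by
          intro X
          rw [card_comp_hole P w, Function.update_of_ne hw]
        have pw := card_pos (hM w hw)
        have cw0 := cw LGraph.empty
        have cwA := cw A
        have cwB := cw B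
        -- replace `A` by `B` in the smaller context
        have e1 : ∀ X : LGraph,
            (P.comp (Function.update (Function.update M i X) w LGraph.empty)).iso
              ((P.comp (Function.update (Function.update M i LGraph.empty) w LGraph.empty)).plug
                (nb P i _) X) := by
          intro X
          have := comp_hole P i (Function.update M w LGraph.empty)
            (Function.update (Function.update M w LGraph.empty) i X)
            (fun v hv => by rw [Function.update_of_ne hv]; exact iso_refl _)
          rw [Function.update_self] at this
          rw [Function.update_comm hw, Function.update_comm hw] at *
          exact this
        have d1 := fun X => iso_card (e1 X)
        have dA := d1 A
        have dB := d1 B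
        rw [card_plug] at dA dB
        have h1 := (IH _ (nb P i _) A B k (by omega) (by omega) (by omega) hk).1 y
          (NN_iso (e1 A) hy)
        replace h1 := NN_iso (iso_symm (e1 B)) h1
        have hle : x * (y * k) ≤ l * k := by
          rw [← mul_assoc]
          exact mul_le_mul_left hxy k
        by_cases nB : Nonempty B.V
        · refine NN_prime_intro hP h4 (hne B nB) (Or.inr ⟨w, x, y * k, ?_, h1, hle⟩)
          rw [Function.update_of_ne hw]
          exact hx
        have zB := card_of_isEmpty (not_nonempty_iff.1 nB)
        have hO : Orth (M w) := by
          refine O _ ?_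
          have := card_block_lt P (by omega) w _ (fun v _ => hne A nA v)
          rw [Function.update_of_ne hw] at this
          omega
        have e2 : ∀ X : LGraph, (P.comp (Function.update (Function.update M i B) w X)).iso
            ((P.comp (Function.update (Function.update M i B) w LGraph.empty)).plug
                (nb P w _) X) := by
          intro X
          have := comp_hole P w (Function.update M i B)
            (Function.update (Function.update M i B) w X)
            (fun v hv => by rw [Function.update_of_ne hv]; exact iso_refl _)
          rw [Function.update_self] at this
          exact this
        have e3 := e2 (M w)
        rw [Function.update_eq_self_iff.2 (Function.update_of_ne hw _ _).symm] at e3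
        have h2 := (IH _ (nb P w _) LGraph.empty (M w) x (by omega)
          (by rw [card_empty]; omega) (by omega)
          (hom_empty inferInstance hO hx)).1 _ (NN_iso (e2 _) h1)
        refine NN_mono ?_ (NN_iso (iso_symm e3) h2)
        rw [mul_comm]
        exact hle

theorem Fstar {n : ℕ} (O : ∀ G : LGraph, Fintype.card G.V < n → Orth G)
    {C : LGraph} {R : Set C.V} {A B : LGraph} {k : GG}
    (hA : Fintype.card C.V + Fintype.card A.V ≤ n) (hB : Fintype.card C.V + Fintype.card B.V ≤ n)
    (h : Hom k A B) : Hom k (C.plug R A) (C.plug R B) :=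
  Fstar_lift (Fstar_half O _ C R A B k rfl hA hB h)
    (Fstar_half O _ C.dual Rᶜ B.dual A.dual k rfl hB hA h.dual)

/-! ## Interaction of a context with its dual -/

namespace LGraph

theorem dual_dual_plug (C : LGraph) (R : Set C.V) (X : LGraph) :
    (C.dual.dual.plug Rᶜᶜ X).iso (C.plug R X) := by
  refine iso_trans (plug_congr_right (iso_symm (dual_dual X)))
    (iso_trans (iso_symm (dual_plug C.dual Rᶜ X.dual)) ?_)
  exact iso_trans (dual_congr (iso_symm (dual_plug C R X))) (dual_dual _)

theorem dual_plug' (C : LGraph) (R : Set C.V) (X : LGraph) :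
    (C.dual.plug Rᶜ X).iso (C.plug R X.dual).dual :=
  iso_trans (plug_congr_right (iso_symm (dual_dual X))) (iso_symm (dual_plug C R X.dual))

open Classical in
/-- Blockwise dual of a family, with one block replaced. -/
noncomputable def updD (P : LGraph) (M : P.V → LGraph) (i : P.V) (X : LGraph) (v : P.V) : LGraph :=
  if v = i then X else (M v).dual

theorem updD_self (P : LGraph) (M : P.V → LGraph) (i : P.V) (X : LGraph) :
    updD P M i X i = X := if_pos rfl

theorem updD_ne (P : LGraph) (M : P.V → LGraph) (i : P.V) (X : LGraph) {v : P.V} (h : v ≠ i) :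
    updD P M i X v = (M v).dual := if_neg h

open Classical in
theorem dual_fam {C : LGraph} {R : Set C.V} {P : LGraph} {i : P.V} {M : P.V → LGraph}
    (hX : ∀ X, (C.plug R X).iso (P.comp (Function.update M i X))) (X : LGraph) :
    (C.dual.plug Rᶜ X).iso (P.dual.comp (updD P M i X)) := by
  refine iso_trans (dual_plug' C R X) (iso_trans (dual_congr (hX _))
    (iso_trans (dual_comp P _) ?_))
  have key : ∀ v : P.V, (Function.update M i X.dual v).dual.iso (updD P M i X v) := by
    intro v
    by_cases hv : v = i
    · subst hv
      rw [Function.update_self, updD_self]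
      exact dual_dual X
    · rw [Function.update_of_ne hv, updD_ne _ _ _ _ hv]
      exact iso_refl _
  exact comp_congr_right (P := P.dual) key

open Classical in
theorem update_dual (P : LGraph) (N : P.V → LGraph) (w : P.V) (X : LGraph) :
    P.dual.comp (Function.update (β := fun _ => LGraph) (α := P.dual.V) N w X) =
      P.dual.comp (fun v : P.V => Function.update N w X v) := rfl

open Classical in
theorem updD_eq_update (P : LGraph) (M : P.V → LGraph) (i : P.V) (X Y : LGraph) :
    Function.update (updD P M i X) i Y = updD P M i Y := by
  funext v
  by_cases hv : v = i
  · subst hv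
    rw [Function.update_self, updD_self]
  · rw [Function.update_of_ne hv, updD_ne _ _ _ _ hv, updD_ne _ _ _ _ hv]

open Classical in
theorem updD_update_ne (P : LGraph) (M : P.V → LGraph) (i w : P.V) (hw : w ≠ i) (X : LGraph) :
    (P.dual.comp (fun v : P.V => Function.update (updD P M i X) w LGraph.empty v)).iso
      (P.dual.comp (updD P (Function.update M w LGraph.empty) i X)) := by
  have key : ∀ v : P.V, (Function.update (updD P M i X) w LGraph.empty v).iso
      (updD P (Function.update M w LGraph.empty) i X v) := by
    intro v
    by_cases hv : v = i
    · subst hv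
      rw [updD_self, Function.update_of_ne (Ne.symm hw), updD_self]
      exact iso_refl _
    · rw [updD_ne _ _ _ _ hv]
      by_cases hvw : v = w
      · subst hvw
        rw [Function.update_self, Function.update_self]
        exact iso_of_isEmpty inferInstance (inferInstanceAs (IsEmpty LGraph.empty.V))
      · rw [Function.update_of_ne hvw, Function.update_of_ne hvw, updD_ne _ _ _ _ hv]
        exact iso_refl _
  exact comp_congr_right (P := P.dual) key

open Classical in
theorem card_update_M (P : LGraph) (M : P.V → LGraph) (i w : P.V) (hw : w ≠ i) (X : LGraph) :
    Fintype.card (P.comp (Function.update M i X)).V =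
      Fintype.card (P.comp (Function.update (Function.update M w LGraph.empty) i X)).V +
        Fintype.card (M w).V := by
  rw [card_comp_hole P w, Function.update_of_ne hw, Function.update_comm hw]

open Classical in
theorem hole_update (P : LGraph) (i : P.V) (M : P.V → LGraph) (X : LGraph) :
    (P.comp (Function.update M i X)).iso
      ((P.comp (Function.update M i LGraph.empty)).plug (nb P i _) X) := by
  have := comp_hole P i M (Function.update M i X)
    (fun v hv => by rw [Function.update_of_ne hv]; exact iso_refl _)
  rwa [Function.update_self] at this

theorem dual_dual_comp (P : LGraph) (M : P.V → LGraph) :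
    (P.dual.dual.comp M).iso (P.comp M) := by
  refine comp_congr (P := P.dual.dual) (Q := P) (Equiv.refl P.V) ?_ (fun v => iso_refl _)
  intro v w
  constructor
  · rintro ⟨h1, h2⟩
    by_contra h
    exact h2 ⟨h1, h⟩
  · intro h
    refine ⟨?_, fun h' => h'.2 h⟩
    rintro rfl
    exact P.irrefl _ h

end LGraph

/-- Induction hypothesis for the interaction lemma. -/
def EIH (n m : ℕ) : Prop :=
  ∀ (C : LGraph) (R : Set C.V) (A B : LGraph) (l1 l2 : GG),
    3 * Fintype.card C.V + Fintype.card A.V + Fintype.card B.V < m →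
    Fintype.card C.V + Fintype.card A.V ≤ n → Fintype.card C.V + Fintype.card B.V ≤ n →
    NN (C.dual.plug Rᶜ A) l1 → NN (C.plug R B) l2 → NN (join False A B) (l1 * l2)

theorem NN_join_empty_right {A B : LGraph} (hB : IsEmpty B.V) {l : GG} :
    NN (join False A B) l ↔ NN A l :=
  ⟨NN_iso (plug_isEmpty _ _ _ hB), NN_iso (iso_symm (plug_isEmpty _ _ _ hB))⟩

theorem NN_join_empty_left {A B : LGraph} (hA : IsEmpty A.V) {l : GG} :
    NN (join False A B) l ↔ NN B l :=
  ⟨NN_iso (plug_ctx_isEmpty _ _ _ hA), NN_iso (iso_symm (plug_ctx_isEmpty _ _ _ hA))⟩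

open Classical in
theorem NN_prime_elim_dual {P : LGraph} {N : P.V → LGraph} {l : GG} (hP : P.Prime)
    (h4 : 4 ≤ Fintype.card P.V) (hN : ∀ v, Nonempty (N v).V) (h : NN (P.dual.comp N) l) :
    (∃ L : P.V → LGraph, (∀ v, Nonempty (L v).V) ∧ (∀ v, NN (N v) (gm (L v))) ∧
        gm (P.dual.comp L) ≤ l) ∨
     (∃ (w : P.V) (x y : GG),
        NN (N w) x ∧ NN (P.dual.comp (fun v : P.V => Function.update N w LGraph.empty v)) y ∧
          x * y ≤ l) :=
  NN_prime_elim (P := P.dual) (dual_prime hP) h4 hN h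

theorem Lstar_dual {n : ℕ} (O : ∀ G : LGraph, Fintype.card G.V < n → Orth G) (Q : LGraph)
    (M L : Q.V → LGraph) (hn : Fintype.card (Q.dual.comp M).V ≤ n)
    (h : ∀ v, NN (M v) (gm (L v))) : NN (Q.dual.comp M) (gm (Q.dual.comp L)) :=
  Lstar O _ Q.dual M L rfl hn h

open Classical in
theorem gm_comp_dual_hole (P : LGraph) (i : P.V) (L : P.V → LGraph) {k : GG}
    (h : 1 ≤ gm (P.dual.comp fun v : P.V => Function.update L i LGraph.empty v) * k) :
    gm (L i) ≤ gm (P.dual.comp L) * k := by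
  rw [gm_eq (comp_hole P.dual i L L (fun w _ => iso_refl _))]
  exact gm_le_plug_mul _ _ h

open Classical in
theorem E_prime {n m : ℕ} (O : ∀ G : LGraph, Fintype.card G.V < n → Orth G) (ih : EIH n m)
    {C : LGraph} {R : Set C.V} {A B : LGraph} {l1 l2 : GG}
    (hm : 3 * Fintype.card C.V + Fintype.card A.V + Fintype.card B.V = m)
    (hA : Fintype.card C.V + Fintype.card A.V ≤ n) (hB : Fintype.card C.V + Fintype.card B.V ≤ n)
    (h1 : NN (C.dual.plug Rᶜ A) l1) (h2 : NN (C.plug R B) l2)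
    {P : LGraph} {i : P.V} {M : P.V → LGraph} (hP : P.Prime) (h4 : 4 ≤ Fintype.card P.V)
    (hM : ∀ w, w ≠ i → Nonempty (M w).V)
    (hX : ∀ X, (C.plug R X).iso (P.comp (Function.update M i X))) (nA : Nonempty A.V) :
    NN (join False A B) (l1 * l2) ∨ (Nonempty B.V ∧ ∃ L : P.V → LGraph,
      (∀ v, Nonempty (L v).V) ∧ (∀ v, NN (updD P M i A v) (gm (L v))) ∧
      gm (P.dual.comp L) ≤ l1) := by
  have pA := card_pos nA
  have hD := dual_fam hX
  have hne : ∀ v, Nonempty (updD P M i A v).V := by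
    intro v
    by_cases hv : v = i
    · subst hv; rw [updD_self]; exact nA
    · rw [updD_ne _ _ _ _ hv]; exact hM v hv
  have cA := iso_card (hX A)
  have cB := iso_card (hX B)
  have cD := iso_card (hD A)
  have cE := iso_card (hX LGraph.empty)
  have cDE := iso_card (hD LGraph.empty)
  rw [card_plug] at cA cB cD cE cDE
  rw [card_empty, add_zero] at cE cDE
  rw [dual_card] at cD cDE
  rcases NN_prime_elim_dual hP h4 hne (NN_iso (hD A) h1) with h | h
  · obtain ⟨L, hL, hL', hl⟩ := h
    by_cases nB : Nonempty B.V
    · exact Or.inr ⟨nB, L, hL, hL', hl⟩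
    have eB := not_nonempty_iff.1 nB
    left
    have k1 : NN (P.dual.comp (updD P M i LGraph.empty))
        (gm (P.dual.comp fun v : P.V => Function.update L i LGraph.empty v)) := by
      refine Lstar_dual O P _ _ (by omega) ?_
      intro v
      have := hL' v
      by_cases hv : v = i
      · rw [hv, Function.update_self, updD_self, NN_empty, gm_empty]
      · rw [Function.update_of_ne hv, updD_ne _ _ _ _ hv]
        rwa [updD_ne _ _ _ _ hv] at this
    have k2 := ih C R LGraph.empty B _ l2 (by rw [card_empty]; omega) (by rw [card_empty]; omega)
      hB (NN_iso (iso_symm (hD _)) k1) h2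
    rw [NN_join_empty_right eB, NN_empty] at k2
    rw [NN_join_empty_right eB]
    have k3 := hL' i
    rw [updD_self] at k3
    refine NN_mono ?_ k3
    exact le_trans (gm_comp_dual_hole P i L k2) (mul_le_mul_left hl l2)
  · left
    obtain ⟨w, x, y, hx, hy, hxy⟩ := h
    by_cases hw : w = i
    · subst hw
      rw [updD_self] at hx
      rw [updD_eq_update] at hy
      have k1 := ih C R LGraph.empty B y l2 (by rw [card_empty]; omega)
        (by rw [card_empty]; omega) hB (NN_iso (iso_symm (hD _)) hy) h2
      rw [NN_join_empty_left (A := LGraph.empty) inferInstance] at k1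
      refine NN_par_intro hx k1 ?_
      rw [← mul_assoc]
      exact mul_le_mul_left hxy l2
    · rw [updD_ne _ _ _ _ hw] at hx
      have pw := card_pos (hM w hw)
      have cw := card_update_M P M i w hw
      have cwE := cw LGraph.empty
      have cwB := cw B
      have cwA := cw A
      have hO : Orth (M w) := by
        refine O _ ?_
        have := card_block_lt P (by omega) w (Function.update M i A) (fun v _ => by
          by_cases hv : v = i
          · subst hv; rw [Function.update_self]; exact nA
          · rw [Function.update_of_ne hv]; exact hM v hv)
        rw [Function.update_of_ne hw] at this
        omega
      have hh : Hom x (M w) LGraph.empty :=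
        (hom_empty (E := LGraph.empty) inferInstance hO.dual hx).dual.iso (dual_dual _)
          (iso_of_isEmpty (inferInstanceAs (IsEmpty LGraph.empty.V)) inferInstance)
      -- remove block `w` on the `B` side
      have e2 := hole_update P w (Function.update M i B)
      have e3 := e2 (M w)
      rw [Function.update_eq_self_iff.2 (Function.update_of_ne hw _ _).symm] at e3
      have e4 := e2 LGraph.empty
      have c3 := iso_card e3
      rw [card_plug] at c3
      have k1 := (Fstar O (R := nb P w _) (by omega) (by rw [card_empty]; omega) hh).1 l2
        (NN_iso (iso_trans (hX B) e3) h2)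
      replace k1 := NN_iso (iso_symm e4) k1
      rw [Function.update_comm (Ne.symm hw)] at k1
      have e5 := hole_update P i (Function.update M w LGraph.empty)
      have e6 := dual_fam (fun X => iso_symm (e5 X))
      have k2 := ih (P.comp (Function.update (Function.update M w LGraph.empty) i LGraph.empty))
        (nb P i _) A B y (l2 * x) (by omega) (by omega) (by omega)
        (NN_iso (iso_trans (updD_update_ne P M i w hw A) (iso_symm (e6 A))) hy)
        (NN_iso (e5 B) k1)
      refine NN_mono ?_ k2
      calc y * (l2 * x) = x * y * l2 := by ac_rfl
        _ ≤ l1 * l2 := mul_le_mul_left hxy l2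

theorem E_join_true {n : ℕ} {C A B : LGraph} {l1 l2 : GG}
    (hC : Orth C) (h1 : NN (join False C.dual A) l1) (h2 : NN (join True C B) l2) :
    NN (join False A B) (l1 * l2) := by
  obtain ⟨x, y, hx, hy, hxy⟩ := NN_par_elim h1
  refine NN_par_intro hy (NN_ten_elim hC h2 x hx) ?_
  calc y * (l2 * x) = x * y * l2 := by ac_rfl
    _ ≤ l1 * l2 := mul_le_mul_left hxy l2

theorem NN_join_swap {A B : LGraph} {x y : GG} (h : NN (join False B A) (y * x)) :
    NN (join False A B) (x * y) := by
  rw [mul_comm]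
  exact NN_iso (join_comm _ _ _) h

theorem Estar {n : ℕ} (O : ∀ G : LGraph, Fintype.card G.V < n → Orth G) (m : ℕ) : EIH n m := by
  classical
  induction m with
  | zero =>
    intro C R A B l1 l2 h
    omega
  | succ m ih =>
  intro C R A B l1 l2 hm hA hB h1 h2
  by_cases hm' : 3 * Fintype.card C.V + Fintype.card A.V + Fintype.card B.V < m
  · exact ih C R A B l1 l2 hm' hA hB h1 h2
  have hm : 3 * Fintype.card C.V + Fintype.card A.V + Fintype.card B.V = m := by omega
  by_cases hC : Nonempty C.V
  swap
  · have hC' := not_nonempty_iff.1 hC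
    exact NN_par_intro (NN_iso (plug_ctx_isEmpty C.dual _ A hC') h1)
      (NN_iso (plug_ctx_isEmpty C R B hC') h2) le_rfl
  have pC := card_pos hC
  by_cases hAB : IsEmpty A.V ∧ IsEmpty B.V
  · obtain ⟨eA, eB⟩ := hAB
    obtain ⟨x⟩ := hC
    obtain ⟨C', R', f, hc, hf, hi, -⟩ := split_vertex C x
    have i1 : (C.dual.plug Rᶜ A).iso (C'.dual.plug R'ᶜ (single (C.label x)).dual) :=
      iso_trans (plug_isEmpty _ _ _ eA) (iso_trans (dual_congr hi) (dual_plug _ _ _))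
    have i2 : (C.plug R B).iso (C'.plug R' (single (C.label x))) :=
      iso_trans (plug_isEmpty _ _ _ eB) hi
    have c1 := card_single (C.label x)
    have c2 : Fintype.card (single (C.label x)).dual.V = 1 := c1
    have k := ih C' R' (single (C.label x)).dual (single (C.label x)) l1 l2
      (by omega) (by omega) (by omega) (NN_iso i1 h1) (NN_iso i2 h2)
    obtain ⟨a, b, ha, hb, hab⟩ := NN_par_elim k
    rw [NN_join_empty_right eB, NN_isEmpty eA]
    refine le_trans ?_ hab
    rw [mul_comm]
    exact orth_single c1 b a hb ha
  have hpos : 0 < Fintype.card A.V + Fintype.card B.V := by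
    by_contra h
    exact hAB ⟨isEmpty_of_card (by omega), isEmpty_of_card (by omega)⟩
  rcases ctx_cases C R hC with h | h | h
  · obtain ⟨E, S, D, T, hE, hD, hED, hX⟩ := h
    have pE := card_pos hE
    have pD := card_pos hD
    have i1 : (C.dual.plug Rᶜ A).iso (E.dual.plug Sᶜ (D.dual.plug Tᶜ A)) := by
      refine iso_trans (dual_plug' C R A) (iso_trans (dual_congr (hX _))
        (iso_trans (dual_plug _ _ _) (plug_congr_right ?_)))
      exact iso_symm (dual_plug' D T A)
    have c1 := card_plug D.dual Tᶜ A
    have c2 := card_plug D T B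
    rw [dual_card] at c1
    have k := ih E S (D.dual.plug Tᶜ A) (D.plug T B) l1 l2 (by omega) (by omega) (by omega)
      (NN_iso i1 h1) (NN_iso (hX B) h2)
    obtain ⟨x, y, hx, hy, hxy⟩ := NN_par_elim k
    exact NN_mono hxy (ih D T A B x y (by omega) (by omega) (by omega) hx hy)
  · obtain ⟨b, rfl⟩ := h
    have hO : Orth C := O C (by omega)
    change NN (join (¬ b) C.dual A) l1 at h1
    change NN (join b C B) l2 at h2
    by_cases hb : b
    · obtain rfl : b = True := eq_true hb
      rw [not_true_eq_false] at h1
      exact E_join_true (n := n) hO h1 h2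
    · obtain rfl : b = False := eq_false hb
      rw [not_false_eq_true] at h1
      refine NN_join_swap (E_join_true (n := n) hO.dual ?_ h1)
      exact NN_iso (join_congr _ (iso_symm (dual_dual C)) (iso_refl _)) h2
  · obtain ⟨P, i, M, hP, h4, hM, hX⟩ := h
    have hD : ∀ X, (C.dual.plug Rᶜ X).iso
        (P.dual.comp (Function.update (α := P.dual.V) (fun v : P.V => (M v).dual) i X)) := by
      intro X
      refine iso_trans (dual_fam hX X) (comp_congr_right (P := P.dual) ?_)
      have key : ∀ v : P.V, (updD P M i X v).iso
          (Function.update (fun v : P.V => (M v).dual) i X v) := by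
        intro v
        by_cases hv : v = i
        · subst hv; rw [updD_self, Function.update_self]; exact iso_refl _
        · rw [updD_ne _ _ _ _ hv, Function.update_of_ne hv]; exact iso_refl _
      exact key
    have h2' := NN_iso (iso_symm (dual_dual_plug C R B)) h2
    have side1 := fun nA => E_prime O ih hm hA hB h1 h2 hP h4 hM hX nA
    have side2 := fun nB => E_prime (C := C.dual) (R := Rᶜ) (A := B) (B := A) O ih
      (by rw [dual_card]; omega) hB hA h2' h1 (P := P.dual) (i := i)
      (M := fun v : P.V => (M v).dual) (dual_prime hP) h4 hM hD nB
    by_cases nA : Nonempty A.V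
    swap
    · have nB : Nonempty B.V := by
        by_contra nB
        exact hAB ⟨not_nonempty_iff.1 nA, not_nonempty_iff.1 nB⟩
      rcases side2 nB with h | h
      · exact NN_join_swap h
      · exact (nA h.1).elim
    rcases side1 nA with h | h
    · exact h
    obtain ⟨nB, L1, hL1, hL1', hl1⟩ := h
    rcases side2 nB with h | h
    · exact NN_join_swap h
    obtain ⟨-, L2, hL2, hL2', hl2⟩ := h
    replace hL2' : ∀ v : P.V, NN (updD P.dual (fun v : P.V => (M v).dual) i B v) (gm (L2 v)) :=
      hL2'
    have pA := card_pos nA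
    have cA := iso_card (hX A)
    rw [card_plug] at cA
    have k := prime_le hP h4 L1 L2 hL1 i (by
      intro w hw
      have a1 := hL1' w
      have a2 := hL2' w
      rw [updD_ne _ _ _ _ hw] at a1
      replace a2 : NN (M w).dual.dual (gm (L2 w)) :=
        (updD_ne P.dual (fun v : P.V => (M v).dual) i B hw) ▸ a2
      have hO : Orth (M w) := by
        refine O _ ?_
        have := card_block_lt P (by omega) w (Function.update M i A) (fun v _ => by
          by_cases hv : v = i
          · subst hv; rw [Function.update_self]; exact nA
          · rw [Function.update_of_ne hv]; exact hM v hv)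
        rw [Function.update_of_ne hw] at this
        omega
      rw [mul_comm]
      exact hO _ _ (NN_dd.1 a2) a1)
    have b1 := hL1' i
    have b2 := hL2' i
    rw [updD_self] at b1
    replace b2 : NN B (gm (L2 i)) :=
      (updD_self P.dual (fun v : P.V => (M v).dual) i B) ▸ b2
    refine NN_par_intro b1 b2 (k.trans (mul_le_mul' hl1 ?_))
    rw [← gm_eq (dual_dual_comp P L2)]
    exact hl2

/-! ## Global consequences -/

theorem orth_lt (n : ℕ) : ∀ G : LGraph, Fintype.card G.V < n → Orth G := by
  induction n with
  | zero => intro G h; omega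
  | succ n ih =>
    intro G hG l k hl hk
    have h := Estar ih (3 * Fintype.card G.V + 1) G Set.univ LGraph.empty LGraph.empty k l
      (by rw [card_empty]; omega) (by rw [card_empty]; omega) (by rw [card_empty]; omega)
      (NN_iso (iso_symm (plug_isEmpty _ _ _ inferInstance)) hk)
      (NN_iso (iso_symm (plug_isEmpty _ _ _ inferInstance)) hl)
    rw [NN_join_empty_right (B := LGraph.empty) inferInstance, NN_empty] at h
    rwa [mul_comm]

theorem orth (G : LGraph) : Orth G := orth_lt _ G (Nat.lt_succ_self _)

theorem plug_hom {C : LGraph} {R : Set C.V} {A B : LGraph} {k : GG} (h : Hom k A B) :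
    Hom k (C.plug R A) (C.plug R B) :=
  Fstar (n := Fintype.card C.V + Fintype.card A.V + Fintype.card B.V) (fun G _ => orth G)
    (by omega) (by omega) h

theorem interact {C : LGraph} {R : Set C.V} {A B : LGraph} {l1 l2 : GG}
    (h1 : NN (C.dual.plug Rᶜ A) l1) (h2 : NN (C.plug R B) l2) :
    NN (join False A B) (l1 * l2) :=
  Estar (n := Fintype.card C.V + Fintype.card A.V + Fintype.card B.V) (fun G _ => orth G) _
    C R A B l1 l2 (Nat.lt_succ_self _) (by omega) (by omega) h1 h2

theorem NN_self (G : LGraph) : NN G (gm G) := by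
  have h := Lstar (n := Fintype.card (G.comp fun v => single (G.label v)).V) (fun G _ => orth G) _
    G (fun v => single (G.label v)) (fun v => single (G.label v)) rfl le_rfl
    (fun v => (NN_one (card_single _)).2 le_rfl)
  rw [gm_eq (self_iso_comp G)]
  exact NN_iso (iso_symm (self_iso_comp G)) h

theorem NN_tensor_intro {A B : LGraph} {l : GG}
    (h1 : ∀ k, NN A.dual k → NN B (l * k)) (h2 : ∀ k, NN B.dual k → NN A (l * k)) :
    NN (join True A B) l := NN_ten_intro (fun G _ => orth G) h1 h2

theorem hom_unit {k : GG} {B : LGraph} (h : NN B k) : Hom k LGraph.empty B :=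
  hom_empty inferInstance (orth B) h

/-! ## Soundness of the rules -/

theorem Hom.refl (A : LGraph) : Hom 1 A A :=
  ⟨fun l hl => (mul_one l).symm ▸ hl, fun l hl => (mul_one l).symm ▸ hl⟩

theorem Hom.trans {k k' : GG} {A B C : LGraph} (h : Hom k A B) (h' : Hom k' B C) :
    Hom (k * k') A C := by
  constructor
  · intro l hl
    have := h'.1 _ (h.1 l hl)
    rwa [mul_assoc] at this
  · intro l hl
    have := h.2 _ (h'.2 l hl)
    rwa [mul_assoc, mul_comm k' k] at this

theorem NN_dual_par {A B : LGraph} {l : GG} :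
    NN (A.par B).dual l ↔ NN (join True A.dual B.dual) l := by
  have e := iso_trans (dual_congr (par_iso_join A B)) (dual_join False A B)
  rw [not_false_eq_true] at e
  exact ⟨NN_iso e, NN_iso (iso_symm e)⟩

theorem NN_dual_tensor {A B : LGraph} {l : GG} :
    NN (A.tensor B).dual l ↔ NN (join False A.dual B.dual) l := by
  have e := iso_trans (dual_congr (tensor_iso_join A B)) (dual_join True A B)
  rw [not_true_eq_false] at e
  exact ⟨NN_iso e, NN_iso (iso_symm e)⟩

theorem NN_par {A B : LGraph} {l : GG} : NN (A.par B) l ↔ NN (join False A B) l :=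
  ⟨NN_iso (par_iso_join A B), NN_iso (iso_symm (par_iso_join A B))⟩

theorem NN_tensor {A B : LGraph} {l : GG} : NN (A.tensor B) l ↔ NN (join True A B) l :=
  ⟨NN_iso (tensor_iso_join A B), NN_iso (iso_symm (tensor_iso_join A B))⟩

theorem hom_cut (A : LGraph) : Hom 1 LGraph.empty (A.tensor A.dual) := by
  constructor
  · intro l hl
    rw [NN_empty] at hl
    rw [mul_one, NN_tensor]
    refine NN_tensor_intro ?_ ?_
    · intro k hk
      exact NN_mono (le_mul_of_one_le_left' hl) hk
    · intro k hk
      exact NN_mono (le_mul_of_one_le_left' hl) (NN_dd.1 hk)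
  · intro j hj
    rw [NN_isEmpty (G := LGraph.empty.dual) (inferInstanceAs (IsEmpty LGraph.empty.V)), mul_one]
    rw [NN_dual_tensor] at hj
    obtain ⟨x, y, hx, hy, hxy⟩ := NN_par_elim hj
    exact (orth A.dual x y hx hy).trans hxy

theorem sound_ai (a : Atom) : Hom 1 ((single (dualAtom a)).par (single a)) LGraph.empty := by
  refine (hom_cut (single a)).dual.iso ?_ ?_
  · have e := iso_trans (dual_congr (tensor_iso_join (single a) (single a).dual))
      (dual_join True _ _)
    rw [not_true_eq_false] at e
    refine iso_trans e (iso_trans (join_congr False ?_ (dual_dual _))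
      (iso_symm (par_iso_join _ _)))
    refine ⟨⟨Equiv.refl _, ?_, fun _ => rfl⟩⟩
    intro v w
    exact ⟨fun h => h.1 rfl, fun h => h.elim⟩
  · exact iso_of_isEmpty (inferInstanceAs (IsEmpty LGraph.empty.V)) inferInstance

theorem sound_ss (A B : LGraph) (S : Set B.V) : Hom 1 (B.par A) (B.plug S A) := by
  have e0 : (B.plug S LGraph.empty).iso B := plug_isEmpty _ _ _ inferInstance
  constructor
  · intro l hl
    rw [NN_par] at hl
    obtain ⟨x, y, hx, hy, hxy⟩ := NN_par_elim hl
    rw [mul_one]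
    exact NN_mono hxy ((plug_hom (C := B) (R := S) (hom_unit hy)).1 x (NN_iso (iso_symm e0) hx))
  · intro j hj
    rw [mul_one, NN_dual_par]
    refine NN_tensor_intro ?_ ?_
    · intro k hk
      have := interact (NN_iso (dual_plug B S A) hj)
        (NN_iso (iso_symm e0) (NN_dd.1 hk))
      rwa [NN_join_empty_right (B := LGraph.empty) inferInstance] at this
    · intro k hk
      have := (plug_hom (C := B) (R := S) (hom_unit (NN_dd.1 hk))).2 j hj
      exact NN_iso (dual_congr e0) this

open Classical in
theorem comp_hom_finset (Q : LGraph) (A B : Q.V → LGraph) (k : Q.V → GG)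
    (h : ∀ v, Hom (k v) (A v) (B v)) (s : Finset Q.V) :
    Hom (∏ v ∈ s, k v) (Q.comp A) (Q.comp fun v => if v ∈ s then B v else A v) := by
  induction s using Finset.induction_on with
  | empty =>
    simp only [Finset.prod_empty, Finset.notMem_empty, if_false]
    exact Hom.refl _
  | insert w s hw ih =>
    rw [Finset.prod_insert hw, mul_comm]
    refine ih.trans ?_
    have e1 := comp_hole Q w (fun v => if v ∈ s then B v else A v)
      (fun v => if v ∈ s then B v else A v) (fun _ _ => iso_refl _)
    have e2 := comp_hole Q w (fun v => if v ∈ s then B v else A v)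
      (fun v => if v ∈ insert w s then B v else A v) (fun v hv => by
        have hiff : (v ∈ insert w s) ↔ v ∈ s := by rw [Finset.mem_insert, or_iff_right hv]
        by_cases hs : v ∈ s
        · rw [if_pos hs, if_pos (hiff.2 hs)]
          exact iso_refl _
        · rw [if_neg hs, if_neg (fun h => hs (hiff.1 h))]
          exact iso_refl _)
    refine (plug_hom ?_).iso (iso_symm e1) (iso_symm e2)
    rw [if_neg hw, if_pos (Finset.mem_insert_self _ _)]
    exact h w

theorem comp_hom {Q : LGraph} {A B : Q.V → LGraph} {k : Q.V → GG}
    (h : ∀ v, Hom (k v) (A v) (B v)) : Hom (∏ v, k v) (Q.comp A) (Q.comp B) := by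
  classical
  have := comp_hom_finset Q A B k h Finset.univ
  simpa only [Finset.mem_univ, if_true] using this

theorem bigTensor_dual_elim : ∀ (n : ℕ) (F : Fin n → LGraph) (j : GG),
    NN (bigTensor n F).dual j →
      ∃ k : Fin n → GG, (∀ w, NN (F w).dual (k w)) ∧ ∏ w, k w ≤ j
  | 0, F, j, h => by
    refine ⟨fun _ => 1, fun w => w.elim0, ?_⟩
    rw [Fin.prod_univ_zero]
    exact (NN_isEmpty (G := (bigTensor 0 F).dual) (inferInstanceAs (IsEmpty LGraph.empty.V))).1 h
  | n + 1, F, j, h => by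
    have h' : NN ((F 0).tensor (bigTensor n fun i => F i.succ)).dual j := h
    rw [NN_dual_tensor] at h'
    obtain ⟨x, y, hx, hy, hxy⟩ := NN_par_elim h'
    obtain ⟨k, hk, hk'⟩ := bigTensor_dual_elim n _ y hy
    refine ⟨Fin.cons x k, ?_, ?_⟩
    · intro w
      refine Fin.cases ?_ (fun i => ?_) w
      · exact hx
      · exact hk i
    · rw [Fin.prod_cons]
      exact (mul_le_mul_right hk' x).trans hxy

theorem bigTensor_intro : ∀ (n : ℕ) (F : Fin (n + 1) → LGraph) (l : GG),
    (∀ (i : Fin (n + 1)) (k : Fin (n + 1) → GG), k i = 1 →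
      (∀ w, w ≠ i → NN (F w).dual (k w)) → NN (F i) (l * ∏ w, k w)) →
    NN (bigTensor (n + 1) F) l
  | 0, F, l, h => by
    have h1 := h 0 (fun _ => 1) rfl (fun w hw => (hw (Fin.ext (by omega))).elim)
    rw [Finset.prod_const_one, mul_one] at h1
    have e : (F 0).iso (bigTensor 1 F) :=
      iso_symm (iso_trans (tensor_iso_join (F 0) LGraph.empty)
        (plug_isEmpty _ _ _ inferInstance))
    exact NN_iso e h1
  | n + 1, F, l, h => by
    change NN ((F 0).tensor (bigTensor (n + 1) fun i => F i.succ)) l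
    rw [NN_tensor]
    refine NN_tensor_intro ?_ ?_
    · intro k0 hk0
      refine bigTensor_intro n _ _ ?_
      intro i k hki hk
      have h1 := h i.succ (Fin.cons k0 k) hki (by
        intro w
        refine Fin.cases ?_ (fun v => ?_) w
        · intro _; exact hk0
        · intro hv
          exact hk v (fun e => hv (e ▸ rfl)))
      rwa [Fin.prod_cons, ← mul_assoc] at h1
    · intro a ha
      obtain ⟨k, hk, hk'⟩ := bigTensor_dual_elim (n + 1) _ a ha
      have h1 := h 0 (Fin.cons 1 k) rfl (by
        intro w
        refine Fin.cases ?_ (fun v => ?_) w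
        · intro hv; exact (hv rfl).elim
        · intro _; exact hk v)
      rw [Fin.prod_cons, one_mul] at h1
      exact NN_mono (mul_le_mul_right hk' l) h1

theorem hom_of_dual_par {A B : LGraph} {k : GG} (h : NN (A.par B).dual k) : Hom k A B.dual := by
  rw [NN_dual_par] at h
  constructor
  · intro l hl
    rw [mul_comm]
    exact NN_ten_elim (orth A.dual) h l (NN_dd.2 hl)
  · intro l hl
    rw [mul_comm]
    exact NN_ten_elim' (orth B.dual) h l hl

theorem sound_p (n : ℕ) (P : LGraph) (e : P.V ≃ Fin n) (M N : Fin n → LGraph) (hn : 4 ≤ n) :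
    Hom 1 ((P.dual.comp fun v => M (e v)).par (P.comp fun v => N (e v)))
      (bigTensor n fun i => (M i).par (N i)) := by
  classical
  have eN : (P.comp fun v => N (e v)).dual.iso (P.dual.comp fun v => (N (e v)).dual) :=
    dual_comp P _
  constructor
  · intro l hl
    rw [mul_one]
    rw [NN_par] at hl
    obtain ⟨x, y, hx, hy, hxy⟩ := NN_par_elim hl
    refine NN_mono hxy ?_
    obtain ⟨n, rfl⟩ : ∃ m, n = m + 1 := ⟨n - 1, by omega⟩
    refine bigTensor_intro n _ _ ?_
    intro i k hki hk
    have hom : Hom (∏ v : P.V, k (e v)) (P.dual.comp fun v => M (e v))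
        (P.dual.comp (updD P (fun v => N (e v)) (e.symm i) (M i))) := by
      refine comp_hom (Q := P.dual) (k := fun v : P.V => k (e v)) ?_
      have key : ∀ v : P.V, Hom (k (e v)) (M (e v))
          (updD P (fun v => N (e v)) (e.symm i) (M i) v) := by
        intro v
        by_cases hv : v = e.symm i
        · subst hv
          rw [updD_self, e.apply_symm_apply, hki]
          exact Hom.refl _
        · rw [updD_ne _ _ _ _ hv]
          exact hom_of_dual_par (hk (e v) (fun h => hv (by rw [← h, e.symm_apply_apply])))
      exact key
    rw [Equiv.prod_comp e k] at hom
    have h1 := hom.1 x hx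
    have e5 := hole_update P (e.symm i) (fun v => N (e v))
    have e6 := dual_fam (fun X => iso_symm (e5 X)) (M i)
    have e7 := e5 (N i)
    rw [Function.update_eq_self_iff.2 (by rw [e.apply_symm_apply])] at e7
    have h2 := interact (NN_iso (iso_symm e6) h1) (NN_iso e7 hy)
    rw [NN_par]
    refine NN_mono (le_of_eq ?_) h2
    ac_rfl
  · intro j hj
    rw [mul_one, NN_dual_par]
    obtain ⟨k, hk, hkj⟩ := bigTensor_dual_elim n _ j hj
    have hom : Hom (∏ v : P.V, k (e v)) (P.dual.comp fun v => M (e v))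
        (P.dual.comp fun v => (N (e v)).dual) :=
      comp_hom (Q := P.dual) (k := fun v : P.V => k (e v))
        (fun v : P.V => hom_of_dual_par (hk (e v)))
    rw [Equiv.prod_comp e k] at hom
    replace hom := hom.iso (iso_refl _) (iso_symm eN)
    refine NN_tensor_intro ?_ ?_
    · intro a ha
      refine NN_mono ?_ (hom.1 a (NN_dd.1 ha))
      rw [mul_comm]
      exact mul_le_mul_left hkj a
    · intro a ha
      refine NN_mono ?_ (hom.2 a ha)
      rw [mul_comm]
      exact mul_le_mul_left hkj a

theorem sound_rule {p c : LGraph} (h : GSRule p c) : Hom 1 c p := by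
  cases h with
  | ai a => exact sound_ai a
  | ss A B S _ _ => exact sound_ss A B S
  | p n P e M N _ hn _ => exact sound_p n P e M N hn

theorem sound {G : LGraph} (h : Provable GSRule G) : ∀ l, NN G l → 1 ≤ l := by
  have h' : Relation.ReflTransGen (fun X Y => X.iso Y ∨ Step GSRule X Y) LGraph.empty G := h
  clear h
  induction h' with
  | refl => exact fun l hl => NN_empty.1 hl
  | tail _ hs ih =>
    intro l hl
    rcases hs with hs | ⟨C, R, p, c, hr, h1, h2⟩
    · exact ih l (NN_iso (iso_symm hs) hl)
    · refine ih l (NN_iso (iso_symm h1) ?_)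
      have := (plug_hom (C := C) (R := R) (sound_rule hr)).1 l (NN_iso h2 hl)
      rwa [mul_one] at this

theorem cut_admissible' (A C : LGraph) (R : Set C.V)
    (h : Provable GSRule (C.plug R (A.tensor A.dual))) :
    Provable GSRule (C.plug R LGraph.empty) := by
  rw [← one_le_gm]
  have h1 := (plug_hom (C := C) (R := R) (hom_cut A)).1 _ (NN_self _)
  rw [mul_one] at h1
  exact sound h _ h1

/-- **Cut admissibility.** The rule `i↑` with premise `A ⊗ Ā` and
conclusion `∅` is admissible for GS: for every graph `A` and context `C[·]_R`,
if `C[A ⊗ Ā]_R` is provable in GS then `C[∅]_R` is provable in GS. -/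
theorem cut_admissible (A C : LGraph) (R : Set C.V)
    (h : Provable GSRule (C.plug R (A.tensor A.dual))) :
    Provable GSRule (C.plug R LGraph.empty) := by
  exact cut_admissible' A C R h

end GSP
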